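/- arXiv:1701.00377 — 2 statements merged into one kernel-verified Lean document; each statement's English description precedes it below -/
import Mathlib

section
/- Let J₁ and J₂ be arcs of {0} × C of the form J_i = {0} × π([a_i, b_i)) with a_i < b_i real numbers and b_i − a_i < 1/2 (i = 1,2). If the groups H_{J₁} and H_{J₂} are isomorphic as abstract groups, then the length b₁ − a₁ of J₁ belongs to the ℚ-vector subspace of ℝ spanned by 1, α, a₂ and b₂. -/
open scoped Classical

/-- The circle `ℝ/ℤ`. -/
abbrev Circ : Type := AddCircle (1 : ℝ)

/-- The projection `π : ℝ → ℝ/ℤ`. -/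
noncomputable def circProj (t : ℝ) : Circ := (t : Circ)

/-- The domain `D = (ℤ/3ℤ) × (ℝ/ℤ)`. -/
abbrev Dom : Type := ZMod 3 × Circ

/-- The arc `I = π([0,1/2))` of the circle. -/
noncomputable def Iarc : Set Circ := circProj '' Set.Ico 0 (1 / 2)

/-- The synchronized rotation of angle `α` on the three circles. -/
noncomputable def rotR (α : ℝ) : Equiv.Perm Dom :=
  (Equiv.refl (ZMod 3)).prodCongr (Equiv.addRight (circProj α))

/-- The lamp transformation `σ`: `(a, x) ↦ (a + 1, x)` for `x ∈ I`, identity elsewhere. -/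
noncomputable def lampSigma : Equiv.Perm Dom where
  toFun p := if p.2 ∈ Iarc then (p.1 + 1, p.2) else p
  invFun p := if p.2 ∈ Iarc then (p.1 - 1, p.2) else p
  left_inv p := by by_cases h : p.2 ∈ Iarc <;> simp [h]
  right_inv p := by by_cases h : p.2 ∈ Iarc <;> simp [h]

/-- The lamplighter group `G = ⟨R, σ⟩ ≤ Perm(D)`. -/
noncomputable def lampGroup (α : ℝ) : Subgroup (Equiv.Perm Dom) :=
  Subgroup.closure {rotR α, lampSigma}


section LL

variable {X : Type*} (A : Type*) [AddCommGroup A] (G : Subgroup (Equiv.Perm X))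
  (gens : Set (X → A))

/-- The shift action of a permutation `g` of `X` on functions `X → A`:
`(g · f)(x) = f (g⁻¹ x)`. -/
def shiftF (g : Equiv.Perm X) (f : X → A) : X → A := fun x => f (g.symm x)

/-- The smallest `G`-invariant additive subgroup of `X → A` containing `gens`. -/
def genInvSubgroup : AddSubgroup (X → A) :=
  sInf {K : AddSubgroup (X → A) | gens ⊆ ↑K ∧ ∀ g ∈ G, ∀ f ∈ K, shiftF A g f ∈ K}

lemma shift_mem_genInvSubgroup {g : Equiv.Perm X} (hg : g ∈ G) {f : X → A}
    (hf : f ∈ genInvSubgroup A G gens) : shiftF A g f ∈ genInvSubgroup A G gens := by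
  rw [genInvSubgroup, AddSubgroup.mem_sInf] at hf ⊢
  intro K hK
  exact hK.2 g hg f (hf K hK)

/-- The action of `G` on the subgroup `genInvSubgroup A G gens`, as a homomorphism to the
multiplicative automorphisms of the corresponding multiplicative group. -/
def llShift : ↥G →* MulAut (Multiplicative ↥(genInvSubgroup A G gens)) where
  toFun g := AddEquiv.toMultiplicative
    { toFun := fun f => ⟨shiftF A (g : Equiv.Perm X) f.1,
        shift_mem_genInvSubgroup A G gens g.2 f.2⟩
      invFun := fun f => ⟨shiftF A ((g⁻¹ : ↥G) : Equiv.Perm X) f.1,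
        shift_mem_genInvSubgroup A G gens (g⁻¹ : ↥G).2 f.2⟩
      left_inv := fun f => by
        apply Subtype.ext
        funext x
        simp [shiftF, Equiv.Perm.inv_def]
      right_inv := fun f => by
        apply Subtype.ext
        funext x
        simp [shiftF, Equiv.Perm.inv_def]
      map_add' := fun f₁ f₂ => rfl }
  map_one' := by
    ext f
    rfl
  map_mul' := fun g h => by
    ext f
    rfl

/-- The lamplighter-like group `F_J ⋊ G`. -/
abbrev LLGroup := (Multiplicative ↥(genInvSubgroup A G gens)) ⋊[llShift A G gens] ↥G

end LL

/-- The arc `{0} × π([a,b))` of the first circle of `D`. -/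
noncomputable def arcJ (a b : ℝ) : Set Dom :=
  ({(0 : ZMod 3)} : Set (ZMod 3)) ×ˢ (circProj '' Set.Ico a b)

/-- The group `H_J = F_J ⋊ G`, where `F_J` is the smallest `G`-invariant subgroup of
`(ℤ/2ℤ)^D` containing the indicator function `1_J`. -/
noncomputable abbrev lampLighterLighter (α : ℝ) (J : Set Dom) :=
  LLGroup (ZMod 2) (lampGroup α) {J.indicator fun _ => (1 : ZMod 2)}

/-! ### Equidistribution -/

open MeasureTheory Filter

lemma fourier_ne_one_of_irr {β : ℝ} (hβ : Irrational β) {n : ℤ} (hn : n ≠ 0) :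
    (fourier n (β : Circ) : ℂ) ≠ 1 := by
  rw [fourier_coe_apply, Ne, Complex.exp_eq_one_iff]
  rintro ⟨k, hk⟩
  have hpi : (2 * (Real.pi : ℂ) * Complex.I) ≠ 0 := Complex.two_pi_I_ne_zero
  have h2 : ((n : ℂ) * (β : ℂ)) = (k : ℂ) := by
    apply mul_left_cancel₀ hpi
    simp only [Complex.ofReal_one, div_one] at hk
    linear_combination hk
  have h3 : (n : ℝ) * β = k := by exact_mod_cast h2
  exact (hβ.intCast_mul hn).ne_int k h3

lemma integral_fourier_zero {β : ℝ} (hβ : Irrational β) {n : ℤ} (hn : n ≠ 0) :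
    ∫ x : Circ, (fourier n x : ℂ) = 0 := by
  have h1 : ∫ x : Circ, (fourier n (x + (β : Circ)) : ℂ) = ∫ x : Circ, (fourier n x : ℂ) :=
    integral_add_right_eq_self (fun x : Circ => (fourier n x : ℂ)) _
  have h2 : ∀ x : Circ, (fourier n (x + (β : Circ)) : ℂ) = fourier n x * fourier n (β : Circ) := by
    intro x
    simp [fourier_apply, smul_add, AddCircle.toCircle_add]
  simp_rw [h2] at h1
  rw [integral_mul_const] at h1
  have h3 : (∫ x : Circ, (fourier n x : ℂ)) * (fourier n (β : Circ) - 1) = 0 := by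
    linear_combination h1
  exact (mul_eq_zero.1 h3).resolve_right (sub_ne_zero.2 (fourier_ne_one_of_irr hβ hn))

def EquiD (β : ℝ) (h : C(Circ, ℂ)) : Prop :=
  ∀ ε : ℝ, 0 < ε → ∀ᶠ N : ℕ in atTop, ∀ x : Circ,
    ‖∑ i ∈ Finset.range N, h (x + i • (β : Circ)) - N * ∫ y : Circ, h y‖ ≤ ε * N

lemma cont_integrable (h : C(Circ, ℂ)) : Integrable (fun x : Circ => h x) :=
  h.continuous.integrable_of_hasCompactSupport (HasCompactSupport.of_compactSpace _)

lemma equiD_add {β : ℝ} {g h : C(Circ, ℂ)} (hg : EquiD β g) (hh : EquiD β h) :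
    EquiD β (g + h) := by
  intro ε he
  filter_upwards [hg (ε / 2) (by linarith), hh (ε / 2) (by linarith)] with N h1 h2 x
  have : ∑ i ∈ Finset.range N, (g + h) (x + i • (β : Circ)) - N * ∫ y : Circ, (g + h) y
      = (∑ i ∈ Finset.range N, g (x + i • (β : Circ)) - N * ∫ y : Circ, g y) +
        (∑ i ∈ Finset.range N, h (x + i • (β : Circ)) - N * ∫ y : Circ, h y) := by
    simp only [ContinuousMap.add_apply]
    rw [integral_add (cont_integrable g) (cont_integrable h), Finset.sum_add_distrib]
    ring
  rw [this]
  refine (norm_add_le _ _).trans ?_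
  have := h1 x
  have := h2 x
  linarith

lemma equiD_smul {β : ℝ} {g : C(Circ, ℂ)} (c : ℂ) (hg : EquiD β g) :
    EquiD β (c • g) := by
  intro ε he
  filter_upwards [hg (ε / (‖c‖ + 1)) (by positivity)] with N h1 x
  have : ∑ i ∈ Finset.range N, (c • g) (x + i • (β : Circ)) - N * ∫ y : Circ, (c • g) y
      = c * (∑ i ∈ Finset.range N, g (x + i • (β : Circ)) - N * ∫ y : Circ, g y) := by
    simp only [ContinuousMap.smul_apply, smul_eq_mul]
    rw [integral_const_mul, ← Finset.mul_sum]
    ring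
  rw [this, norm_mul]
  have h2 := h1 x
  calc _ ≤ ‖c‖ * (ε / (‖c‖ + 1) * N) := by gcongr
    _ ≤ (‖c‖ + 1) * (ε / (‖c‖ + 1) * N) := by gcongr; linarith
    _ = ε * N := by field_simp

lemma equiD_fourier {β : ℝ} (hβ : Irrational β) (n : ℤ) : EquiD β (fourier n) := by
  intro ε he
  by_cases hn : n = 0
  · subst hn
    filter_upwards with N x
    simp only [fourier_zero]
    simp [Measure.real]
    positivity
  rw [integral_fourier_zero hβ hn]
  set q : ℂ := fourier n (β : Circ) with hq
  have hq1 : q ≠ 1 := fourier_ne_one_of_irr hβ hn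
  have hqn : ‖q‖ = 1 := by rw [hq, fourier_apply]; exact Circle.norm_coe _
  have key : ∀ x : Circ, ∀ N : ℕ, ∑ i ∈ Finset.range N, (fourier n (x + i • (β : Circ)) : ℂ)
      = fourier n x * ((q ^ N - 1) / (q - 1)) := by
    intro x N
    rw [← geom_sum_eq hq1, Finset.mul_sum]
    refine Finset.sum_congr rfl fun i _ => ?_
    simp only [fourier_apply, smul_add, AddCircle.toCircle_add, hq, Circle.coe_mul]
    rw [smul_comm, AddCircle.toCircle_nsmul, Circle.coe_pow]
  have hb : ∀ x : Circ, ∀ N : ℕ,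
      ‖∑ i ∈ Finset.range N, (fourier n (x + i • (β : Circ)) : ℂ)‖ ≤ 2 / ‖q - 1‖ := by
    intro x N
    rw [key, norm_mul, norm_div]
    have : ‖(fourier n x : ℂ)‖ = 1 := by rw [fourier_apply]; exact Circle.norm_coe _
    rw [this, one_mul]
    gcongr
    refine (norm_sub_le _ _).trans ?_
    simp [hqn]; norm_num
  filter_upwards [eventually_ge_atTop (Nat.ceil (2 / ‖q - 1‖ / ε))] with N hN x
  rw [mul_zero, sub_zero]
  refine (hb x N).trans ?_
  have := Nat.ceil_le.1 hN
  rw [div_le_iff₀ he] at this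
  linarith

lemma equiD_all {β : ℝ} (hβ : Irrational β) (h : C(Circ, ℂ)) : EquiD β h := by
  have hspan : ∀ g ∈ Submodule.span ℂ (Set.range (@fourier (1 : ℝ))), EquiD β g := by
    intro g hg
    induction hg using Submodule.span_induction with
    | mem x hx => obtain ⟨n, rfl⟩ := hx; exact equiD_fourier hβ n
    | zero => 
      intro ε he
      filter_upwards with N x
      simp
      positivity
    | add x y _ _ hx hy => exact equiD_add hx hy
    | smul a x _ hx => exact equiD_smul a hx
  intro ε he
  have hmem : h ∈ (Submodule.span ℂ (Set.range (@fourier (1 : ℝ)))).topologicalClosure := by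
    rw [span_fourier_closure_eq_top]; trivial
  obtain ⟨g, hg, hgd⟩ := Metric.mem_closure_iff.1 hmem (ε / 3) (by linarith)
  have hpt : ∀ x, ‖h x - g x‖ ≤ ε / 3 := by
    intro x
    have := ContinuousMap.dist_apply_le_dist (f := h) (g := g) x
    rw [dist_eq_norm] at this
    linarith
  filter_upwards [hspan g hg (ε / 3) (by linarith)] with N h1 x
  have hN : ‖(N : ℂ)‖ = N := by simp
  have e1 : ‖∑ i ∈ Finset.range N, (h (x + i • (β : Circ)) - g (x + i • (β : Circ)))‖ ≤
      N * (ε / 3) := by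
    refine (norm_sum_le_of_le _ (fun i _ => hpt _)).trans ?_
    simp
  have e2 : ‖(∫ y : Circ, h y) - ∫ y : Circ, g y‖ ≤ ε / 3 := by
    rw [← integral_sub (cont_integrable h) (cont_integrable g)]
    refine (norm_integral_le_of_norm_le_const (C := ε / 3) (Eventually.of_forall hpt)).trans ?_
    simp [Measure.real]
  have : ∑ i ∈ Finset.range N, h (x + i • (β : Circ)) - N * ∫ y : Circ, h y
      = (∑ i ∈ Finset.range N, (h (x + i • (β : Circ)) - g (x + i • (β : Circ)))) +
        (∑ i ∈ Finset.range N, g (x + i • (β : Circ)) - N * ∫ y : Circ, g y)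
        - N * ((∫ y : Circ, h y) - ∫ y : Circ, g y) := by
    rw [Finset.sum_sub_distrib]
    ring
  rw [this]
  refine (norm_sub_le _ _).trans ?_
  have e3 : ‖(N : ℂ) * ((∫ y : Circ, h y) - ∫ y : Circ, g y)‖ ≤ N * (ε / 3) := by
    rw [norm_mul, hN]; gcongr
  have := norm_add_le (∑ i ∈ Finset.range N, (h (x + i • (β : Circ)) - g (x + i • (β : Circ))))
        (∑ i ∈ Finset.range N, g (x + i • (β : Circ)) - N * ∫ y : Circ, g y)
  have := h1 x
  linarith

/-- Uniform upper bound on visits. -/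
lemma visits_lt {β : ℝ} (hβ : Irrational β) {A : Set Circ} {c : ℝ}
    (hc : (volume (closure A)).toReal < c) :
    ∀ᶠ N : ℕ in atTop, ∀ x : Circ,
      (((Finset.range N).filter fun i => x + i • (β : Circ) ∈ A).card : ℝ) ≤ c * N := by
  have hc0 : 0 ≤ c := ENNReal.toReal_nonneg.trans hc.le
  have hc' : volume (closure A) < ENNReal.ofReal c := by
    rw [ENNReal.lt_ofReal_iff_toReal_lt (measure_ne_top _ _)]; exact hc
  obtain ⟨U, hAU, hU, hUc⟩ := (closure A).exists_isOpen_lt_of_lt _ hc'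
  obtain ⟨f, f0, f1, f01⟩ := exists_continuous_zero_one_of_isClosed
    hU.isClosed_compl (isClosed_closure (s := A))
    (Set.disjoint_left.2 fun x hx hx2 => hx (hAU hx2))
  let h : C(Circ, ℂ) := ⟨fun x => (f x : ℂ), by fun_prop⟩
  have h_intg : ∫ y : Circ, h y = ((∫ y : Circ, f y : ℝ) : ℂ) := integral_ofReal
  have hUr : (volume U).toReal < c := by
    rwa [ENNReal.lt_ofReal_iff_toReal_lt (measure_ne_top _ _)] at hUc
  have hle : ∫ y : Circ, f y ≤ (volume U).toReal := by
    have e : ∫ y : Circ, U.indicator (fun _ => (1 : ℝ)) y = (volume U).toReal := by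
      rw [integral_indicator hU.measurableSet]; simp [Measure.real]
    rw [← e]
    refine integral_mono
      (f.continuous.integrable_of_hasCompactSupport (HasCompactSupport.of_compactSpace _))
      ((integrable_const _).indicator hU.measurableSet) fun y => ?_
    by_cases hy : y ∈ U
    · simp [hy, (f01 y).2]
    · simp [hy, f0 (show y ∈ Uᶜ from hy)]
  filter_upwards [equiD_all hβ h (c - (volume U).toReal) (by linarith)] with N hN x
  have h1 := hN x
  rw [h_intg] at h1
  have h2 : ∑ i ∈ Finset.range N, h (x + i • (β : Circ)) - N * ((∫ y : Circ, f y : ℝ) : ℂ)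
     = ((∑ i ∈ Finset.range N, f (x + i • (β : Circ)) - N * ∫ y : Circ, f y : ℝ) : ℂ) := by
    simp [h]
  rw [h2, Complex.norm_real] at h1
  have h3 := (le_abs_self _).trans h1
  have h4 : (((Finset.range N).filter fun i => x + i • (β : Circ) ∈ A).card : ℝ) ≤
      ∑ i ∈ Finset.range N, f (x + i • (β : Circ)) := by
    rw [Finset.card_filter, Nat.cast_sum]
    refine Finset.sum_le_sum fun i _ => ?_
    split_ifs with hi
    · simp [f1 (subset_closure hi)]
    · simpa using (f01 _).1
  have h5 : (N : ℝ) * ∫ y : Circ, f y ≤ N * (volume U).toReal := by gcongr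
  nlinarith

/-- Average lower bound on visits. -/
lemma exists_visits_ge (β : ℝ) {B : Set Circ} (hB : MeasurableSet B) (N : ℕ) :
    ∃ x : Circ, (volume B).toReal * N ≤
      (((Finset.range N).filter fun i => x + i • (β : Circ) ∈ B).card : ℝ) := by
  let f : Circ → ℝ := B.indicator 1
  have hfi : Integrable f := (integrable_const (1 : ℝ)).indicator hB
  have e : ∫ y : Circ, f y = (volume B).toReal := by
    rw [integral_indicator hB]; simp [Measure.real]
  have hcard : ∀ x : Circ, (((Finset.range N).filter fun i => x + i • (β : Circ) ∈ B).card : ℝ)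
      = ∑ i ∈ Finset.range N, f (x + i • (β : Circ)) := by
    intro x
    rw [Finset.card_filter, Nat.cast_sum]
    refine Finset.sum_congr rfl fun i _ => ?_
    simp [f, Set.indicator_apply]
  have h_intg : ∫ x : Circ, ∑ i ∈ Finset.range N, f (x + i • (β : Circ)) = N * (volume B).toReal := by
    rw [integral_finsetSum _ fun i _ => hfi.comp_add_right _]
    simp_rw [integral_add_right_eq_self f]
    simp [e]
  have : IsProbabilityMeasure (volume : Measure Circ) := ⟨by simp⟩
  obtain ⟨x, hx⟩ := exists_integral_le (μ := (volume : Measure Circ))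
    (integrable_finsetSum (Finset.range N) fun i _ => hfi.comp_add_right (i • (β : Circ)))
  rw [h_intg] at hx
  exact ⟨x, by rw [hcard, mul_comm]; exact hx⟩

lemma measure_le_of_pattern {β γ : ℝ} (hγ : Irrational γ) {A B : Set Circ}
    (hB : MeasurableSet B) (hA : volume (closure A) = volume A)
    (h : ∀ S : Finset ℕ, (∃ x : Circ, ∀ i ∈ S, x + i • (β : Circ) ∈ B) →
      ∃ x : Circ, ∀ i ∈ S, x + i • (γ : Circ) ∈ A) :
    (volume B).toReal ≤ (volume A).toReal := by
  by_contra! hcon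
  obtain ⟨c, hc1, hc2⟩ := exists_between hcon
  rw [← hA] at hc1
  obtain ⟨N, hN, hN0⟩ := ((visits_lt hγ hc1).and (eventually_gt_atTop 0)).exists
  obtain ⟨x, hx⟩ := exists_visits_ge β hB N
  obtain ⟨y, hy⟩ := h ((Finset.range N).filter fun i => x + i • (β : Circ) ∈ B)
    ⟨x, fun i hi => (Finset.mem_filter.1 hi).2⟩
  have h1 := hN y
  have h2 : ((Finset.range N).filter fun i => x + i • (β : Circ) ∈ B).card ≤
     ((Finset.range N).filter fun i => y + i • (γ : Circ) ∈ A).card := by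
    refine Finset.card_le_card fun i hi => ?_
    exact Finset.mem_filter.2 ⟨(Finset.mem_filter.1 hi).1, hy i hi⟩
  have h3 : (((Finset.range N).filter fun i => x + i • (β : Circ) ∈ B).card : ℝ) ≤
     ((Finset.range N).filter fun i => y + i • (γ : Circ) ∈ A).card := by exact_mod_cast h2
  have : (0 : ℝ) < N := by exact_mod_cast hN0
  nlinarith

/-! ### Step functions -/

def Stp (V : Submodule ℚ ℝ) {τ : Type*} (h : Circ → τ) : Prop :=
  ∃ P : Set Circ, P.Finite ∧ (∀ p ∈ P, ∃ v ∈ V, (v : Circ) = p) ∧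
    ∀ x y : ℝ, x ≤ y → (∀ z : ℝ, x < z → z ≤ y → (z : Circ) ∉ P) → h x = h y

lemma stp_const (V : Submodule ℚ ℝ) {τ : Type*} (t : τ) : Stp V (fun _ : Circ => t) :=
  ⟨∅, Set.finite_empty, by simp, fun _ _ _ _ => rfl⟩

lemma stp_map {V : Submodule ℚ ℝ} {τ υ : Type*} {h : Circ → τ} (hh : Stp V h) (F : τ → υ) :
    Stp V (fun x => F (h x)) := by
  obtain ⟨P, h1, h2, h3⟩ := hh
  exact ⟨P, h1, h2, fun x y hxy hz => congrArg F (h3 x y hxy hz)⟩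

lemma stp_map2 {V : Submodule ℚ ℝ} {τ τ' υ : Type*} {h : Circ → τ} {k : Circ → τ'}
    (hh : Stp V h) (hk : Stp V k) (F : τ → τ' → υ) :
    Stp V (fun x => F (h x) (k x)) := by
  obtain ⟨P, h1, h2, h3⟩ := hh
  obtain ⟨Q, k1, k2, k3⟩ := hk
  refine ⟨P ∪ Q, h1.union k1, ?_, fun x y hxy hz => ?_⟩
  · rintro p (hp | hp)
    exacts [h2 p hp, k2 p hp]
  · beta_reduce
    rw [h3 x y hxy fun z a b c => hz z a b (Or.inl c), k3 x y hxy fun z a b c => hz z a b (Or.inr c)]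

lemma stp_translate {V : Submodule ℚ ℝ} {τ : Type*} {h : Circ → τ} (hh : Stp V h) {v : ℝ}
    (hv : v ∈ V) : Stp V (fun x => h (x + (v : Circ))) := by
  obtain ⟨P, h1, h2, h3⟩ := hh
  refine ⟨(fun p => p - (v : Circ)) '' P, h1.image _, ?_, fun x y hxy hz => ?_⟩
  · rintro _ ⟨p, hp, rfl⟩
    obtain ⟨w, hw, rfl⟩ := h2 p hp
    exact ⟨w - v, V.sub_mem hw hv, by simp⟩
  · have := h3 (x + v) (y + v) (by linarith) fun z a b c => by
      refine hz (z - v) (by linarith) (by linarith) ⟨z, c, by simp⟩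
    simpa using this

lemma circ_eq_iff {x y : ℝ} : (x : Circ) = (y : Circ) ↔ ∃ k : ℤ, y = x + k := by
  rw [eq_comm, ← sub_eq_zero, ← AddCircle.coe_sub, AddCircle.coe_eq_zero_iff]
  constructor
  · rintro ⟨n, hn⟩
    refine ⟨n, ?_⟩
    simp at hn
    linarith
  · rintro ⟨n, hn⟩
    refine ⟨n, ?_⟩
    simp
    linarith

lemma mem_arc {x a b : ℝ} : (x : Circ) ∈ circProj '' Set.Ico a b ↔
    ∃ k : ℤ, a ≤ x + k ∧ x + k < b := by
  constructor
  · rintro ⟨y, hy, hxy⟩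
    obtain ⟨k, rfl⟩ := circ_eq_iff.1 hxy.symm
    exact ⟨k, hy.1, hy.2⟩
  · rintro ⟨k, h1, h2⟩
    exact ⟨x + k, ⟨h1, h2⟩, (circ_eq_iff.2 ⟨k, rfl⟩).symm⟩

lemma stp_arc {V : Submodule ℚ ℝ} {a b : ℝ} (ha : a ∈ V) (hb : b ∈ V) :
    Stp V (fun x => x ∈ circProj '' Set.Ico a b) := by
  refine ⟨{(a : Circ), (b : Circ)}, by simp, ?_, fun x y hxy hz => ?_⟩
  · rintro p (rfl | rfl)
    exacts [⟨a, ha, rfl⟩, ⟨b, hb, rfl⟩]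
  · beta_reduce
    rw [mem_arc, mem_arc]
    apply propext
    constructor
    · rintro ⟨k, h1, h2⟩
      refine ⟨k, by linarith, ?_⟩
      by_contra! h
      refine hz (b - k) (by linarith) (by linarith) (Or.inr ?_)
      exact circ_eq_iff.2 ⟨k, by simp⟩
    · rintro ⟨k, h1, h2⟩
      refine ⟨k, ?_, by linarith⟩
      by_contra! h
      refine hz (a - k) (by linarith) (by linarith) (Or.inl ?_)
      exact circ_eq_iff.2 ⟨k, by simp⟩

lemma continuous_coeC : Continuous (fun x : ℝ => (x : Circ)) := AddCircle.continuous_mk' 1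

lemma stp_right {V : Submodule ℚ ℝ} {τ : Type*} {h : Circ → τ} (hh : Stp V h) (x : ℝ) :
    ∃ ε > 0, ∀ y : ℝ, x ≤ y → y < x + ε → h y = h x := by
  obtain ⟨P, h1, h2, h3⟩ := hh
  have hcl : IsOpen ((P \ {(x : Circ)})ᶜ) := (h1.subset Set.sdiff_subset).isClosed.isOpen_compl
  have hop := hcl.preimage continuous_coeC
  obtain ⟨δ, hδ, hb⟩ := Metric.isOpen_iff.1 hop x (by simp)
  refine ⟨min δ 1, by positivity, fun y hy hy2 => (h3 x y hy fun z hz1 hz2 hz => ?_).symm⟩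
  have l1 := min_le_left δ 1
  have l2 := min_le_right δ 1
  have hzb : z ∈ Metric.ball x δ := by
    rw [Metric.mem_ball, Real.dist_eq, abs_of_pos (by linarith)]
    linarith
  have := hb hzb
  simp only [Set.mem_preimage, Set.mem_compl_iff, Set.mem_sdiff, not_and, not_not] at this
  obtain ⟨k, hk⟩ := circ_eq_iff.1 (this hz)
  have hk1 : (k : ℝ) < 0 := by linarith
  have hk2 : (-1 : ℝ) < k := by linarith
  have : k < 0 := by exact_mod_cast hk1
  have : -1 < k := by exact_mod_cast hk2
  omega

lemma stp_closure_subset {V : Submodule ℚ ℝ} {A : Set Circ} (hh : Stp V (fun x => x ∈ A)) :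
    (closure A \ A).Finite := by
  obtain ⟨P, h1, h2, h3⟩ := hh
  refine h1.subset ?_
  rintro p ⟨hp, hpA⟩
  by_contra hpP
  obtain ⟨x, rfl⟩ := QuotientAddGroup.mk_surjective p
  have hop := h1.isClosed.isOpen_compl.preimage continuous_coeC
  obtain ⟨δ, hδ, hb⟩ := Metric.isOpen_iff.1 hop x hpP
  have ho : IsOpen ((fun x : ℝ => (x : Circ)) '' Metric.ball x δ) :=
    QuotientAddGroup.isOpenMap_coe _ Metric.isOpen_ball
  obtain ⟨_, ⟨y, hy, rfl⟩, hyA⟩ := mem_closure_iff.1 hp _ ho ⟨x, by simpa using hδ, rfl⟩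
  apply hpA
  rw [Metric.mem_ball, Real.dist_eq, abs_lt] at hy
  have hball : ∀ z : ℝ, x - δ < z → z < x + δ → (z : Circ) ∉ P := fun z h1 h2 => hb (by
    rw [Metric.mem_ball, Real.dist_eq, abs_lt]; constructor <;> linarith)
  rcases le_total x y with hxy | hxy
  · have := h3 x y hxy fun z a b => hball z (by linarith) (by linarith)
    exact cast this.symm hyA
  · have := h3 y x hxy fun z a b => hball z (by linarith) (by linarith)
    exact cast this hyA

lemma stp_meas {V : Submodule ℚ ℝ} {A : Set Circ} (hh : Stp V (fun x => x ∈ A)) :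
    MeasurableSet A := by
  have h := (stp_closure_subset hh).measurableSet
  have : A = closure A \ (closure A \ A) := by
    rw [Set.sdiff_sdiff_cancel_left subset_closure]
  rw [this]
  exact isClosed_closure.measurableSet.diff h

lemma circ_singleton (p : Circ) : volume ({p} : Set Circ) = 0 := by
  obtain ⟨x, rfl⟩ := QuotientAddGroup.mk_surjective p
  have := AddCircle.volume_closedBall (T := 1) (x := (x : Circ)) 0
  simpa using this

lemma stp_closure_vol {V : Submodule ℚ ℝ} {A : Set Circ} (hh : Stp V (fun x => x ∈ A)) :
    volume (closure A) = volume A := by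
  have h := (stp_closure_subset hh)
  have h0 : volume (closure A \ A) = 0 := by
    have : closure A \ A = ⋃ p ∈ closure A \ A, {p} := (Set.biUnion_of_singleton _).symm
    rw [this, measure_biUnion_null_iff h.countable]
    intro p _
    exact circ_singleton p
  refine le_antisymm ?_ (measure_mono subset_closure)
  calc volume (closure A) ≤ volume (A ∪ (closure A \ A)) := measure_mono (by
        intro x hx; by_cases hxA : x ∈ A <;> simp [hx, hxA])
    _ ≤ volume A + volume (closure A \ A) := measure_union_le _ _
    _ = volume A := by rw [h0, add_zero]

lemma vol_eq {A : Set Circ} (hA : MeasurableSet A) :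
    volume A = volume (Set.Ico (0 : ℝ) 1 ∩ {x : ℝ | (x : Circ) ∈ A}) := by
  have := (UnitAddCircle.measurePreserving_mk 0).measure_preimage hA.nullMeasurableSet
  rw [← this, Measure.restrict_congr_set (Ico_ae_eq_Ioc (μ := volume) (a := (0 : ℝ)) (b := 0 + 1)).symm,
    Measure.restrict_apply (continuous_coeC.measurable hA), zero_add, Set.inter_comm]
  rfl

lemma stp_measure {V : Submodule ℚ ℝ} (hV : (1 : ℝ) ∈ V) {A : Set Circ}
    (hh : Stp V (fun x => x ∈ A)) : (volume A).toReal ∈ V := by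
  have hm := stp_meas hh
  rw [vol_eq hm]
  obtain ⟨P, h1, h2, h3⟩ := hh
  have hmA : MeasurableSet {x : ℝ | (x : Circ) ∈ A} := continuous_coeC.measurable hm
  have hPV : ∀ z : ℝ, (z : Circ) ∈ P → z ∈ V := by
    intro z hz
    obtain ⟨v, hv, hvz⟩ := h2 _ hz
    obtain ⟨k, rfl⟩ := circ_eq_iff.1 hvz
    refine V.add_mem hv ?_
    have := V.smul_mem (k : ℚ) hV
    simpa [Rat.smul_def] using this
  have hfin : (Set.Ioo (0 : ℝ) 1 ∩ {z : ℝ | (z : Circ) ∈ P}).Finite := by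
    refine Set.Finite.of_finite_image (f := fun z : ℝ => (z : Circ)) (h1.subset ?_) ?_
    · rintro _ ⟨z, hz, rfl⟩; exact hz.2
    · intro x hx y hy hxy
      obtain ⟨k, hk⟩ := circ_eq_iff.1 hxy
      have a := hx.1.1
      have b := hx.1.2
      have c := hy.1.1
      have d := hy.1.2
      have e : (k : ℝ) < 1 := by linarith
      have f : (-1 : ℝ) < k := by linarith
      have e' : k < 1 := by exact_mod_cast e
      have f' : -1 < k := by exact_mod_cast f
      have : k = 0 := by omega
      subst this
      simpa using hk.symm
  have hconst : ∀ s t : ℝ, s ∈ V → t ∈ V → s ≤ t → (∀ z : ℝ, s < z → z < t → (z : Circ) ∉ P) →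
      (volume (Set.Ico s t ∩ {x : ℝ | (x : Circ) ∈ A})).toReal ∈ V := by
    intro s t hs ht hst hz
    have hc : ∀ y : ℝ, s ≤ y → y < t → ((s : Circ) ∈ A) = ((y : Circ) ∈ A) := fun y hy hy2 =>
      h3 s y hy fun z a b => hz z a (by linarith)
    by_cases hsA : (s : Circ) ∈ A
    · have : Set.Ico s t ∩ {x : ℝ | (x : Circ) ∈ A} = Set.Ico s t := by
        refine Set.inter_eq_left.2 fun y hy => ?_
        exact (hc y hy.1 hy.2) ▸ hsA
      rw [this, Real.volume_Ico, ENNReal.toReal_ofReal (by linarith)]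
      exact V.sub_mem ht hs
    · have : Set.Ico s t ∩ {x : ℝ | (x : Circ) ∈ A} = ∅ := by
        ext y
        simp only [Set.mem_inter_iff, Set.mem_ofPred_eq, Set.mem_empty_iff_false, iff_false, not_and]
        intro hy hyA
        exact hsA ((hc y hy.1 hy.2).symm ▸ hyA)
      rw [this]
      simp
  have main : ∀ n : ℕ, ∀ t : ℝ, 0 ≤ t → t ≤ 1 → t ∈ V →
      (Set.Ioo (0 : ℝ) t ∩ {z : ℝ | (z : Circ) ∈ P}).ncard ≤ n →
      (volume (Set.Ico 0 t ∩ {x : ℝ | (x : Circ) ∈ A})).toReal ∈ V := by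
    intro n
    induction n with
    | zero =>
      intro t h0 h1t ht hn
      have hf : (Set.Ioo (0 : ℝ) t ∩ {z : ℝ | (z : Circ) ∈ P}).Finite :=
        hfin.subset (Set.inter_subset_inter_left _ (Set.Ioo_subset_Ioo_right h1t))
      have he := (Set.ncard_eq_zero hf).1 (Nat.le_zero.1 hn)
      refine hconst 0 t V.zero_mem ht h0 fun z a b c => ?_
      have : z ∈ (∅ : Set ℝ) := he ▸ ⟨⟨a, b⟩, c⟩
      exact this
    | succ n ih =>
      intro t h0 h1t ht hn
      have hf : (Set.Ioo (0 : ℝ) t ∩ {z : ℝ | (z : Circ) ∈ P}).Finite :=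
        hfin.subset (Set.inter_subset_inter_left _ (Set.Ioo_subset_Ioo_right h1t))
      rcases Set.eq_empty_or_nonempty (Set.Ioo (0 : ℝ) t ∩ {z : ℝ | (z : Circ) ∈ P}) with he | hne
      · refine hconst 0 t V.zero_mem ht h0 fun z a b c => ?_
        have : z ∈ (∅ : Set ℝ) := he ▸ ⟨⟨a, b⟩, c⟩
        exact this
      obtain ⟨m, hmm, hmax⟩ := Set.exists_max_image _ (fun z => z) hf hne
      have hmV := hPV m hmm.2
      have i1 := ih m hmm.1.1.le (by linarith [hmm.1.2]) hmV (by
        have : (Set.Ioo (0 : ℝ) m ∩ {z : ℝ | (z : Circ) ∈ P}).ncard <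
            (Set.Ioo (0 : ℝ) t ∩ {z : ℝ | (z : Circ) ∈ P}).ncard := by
          refine Set.ncard_lt_ncard ?_ hf
          refine (Set.ssubset_iff_of_subset
            (Set.inter_subset_inter_left _ (Set.Ioo_subset_Ioo_right hmm.1.2.le))).2 ⟨m, hmm, ?_⟩
          simp
        omega)
      have i2 := hconst m t hmV ht hmm.1.2.le fun z a b c => by
        have := hmax z ⟨⟨hmm.1.1.trans a, b⟩, c⟩
        linarith
      have hu : Set.Ico 0 t ∩ {x : ℝ | (x : Circ) ∈ A} = (Set.Ico 0 m ∩ {x : ℝ | (x : Circ) ∈ A}) ∪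
          (Set.Ico m t ∩ {x : ℝ | (x : Circ) ∈ A}) := by
        rw [← Set.union_inter_distrib_right, Set.Ico_union_Ico_eq_Ico hmm.1.1.le hmm.1.2.le]
      have hd : Disjoint (Set.Ico 0 m ∩ {x : ℝ | (x : Circ) ∈ A})
          (Set.Ico m t ∩ {x : ℝ | (x : Circ) ∈ A}) := by
        refine Set.disjoint_left.2 fun y hy hy2 => ?_
        exact absurd hy.1.2 (not_lt.2 hy2.1.1)
      rw [hu, measure_union hd (measurableSet_Ico.inter hmA), ENNReal.toReal_add]
      · exact V.add_mem i1 i2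
      · exact measure_ne_top_of_subset Set.inter_subset_left (by simp)
      · exact measure_ne_top_of_subset Set.inter_subset_left (by simp)
  exact main _ 1 zero_le_one le_rfl hV le_rfl

lemma arc_measure {a b : ℝ} (hab : a ≤ b) (h : b - a ≤ 1) :
    (volume (circProj '' Set.Ico a b)).toReal = b - a := by
  have hm : MeasurableSet (circProj '' Set.Ico a b) :=
    stp_meas (V := ⊤) (stp_arc (Submodule.mem_top) (Submodule.mem_top))
  have := (UnitAddCircle.measurePreserving_mk a).measure_preimage hm.nullMeasurableSet
  rw [← this, Measure.restrict_congr_set (Ico_ae_eq_Ioc (μ := volume) (a := a) (b := a + 1)).symm,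
    Measure.restrict_apply (continuous_coeC.measurable hm)]
  have e : (fun x : ℝ => (x : Circ)) ⁻¹' (circProj '' Set.Ico a b) ∩ Set.Ico a (a + 1) =
      Set.Ico a b := by
    ext x
    simp only [Set.mem_inter_iff, Set.mem_preimage, mem_arc, Set.mem_Ico]
    constructor
    · rintro ⟨⟨k, h1, h2⟩, h3, h4⟩
      have e : (k : ℝ) < 1 := by linarith
      have f : (-1 : ℝ) < k := by linarith
      have e' : k < 1 := by exact_mod_cast e
      have f' : -1 < k := by exact_mod_cast f
      have : k = 0 := by omega
      subst this
      simp at h1 h2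
      exact ⟨h1, h2⟩
    · rintro ⟨h1, h2⟩
      exact ⟨⟨0, by simpa using h1, by simpa using h2⟩, h1, by linarith⟩
  rw [e, Real.volume_Ico, ENNReal.toReal_ofReal (by linarith)]

/-! ### The group `G` -/

def LampForm (α : ℝ) (g : Equiv.Perm Dom) (n : ℤ) (φ : Circ → ZMod 3) : Prop :=
  ∀ a x, g (a, x) = (a + φ x, x + ((n * α : ℝ) : Circ))

lemma frm_symm {α : ℝ} {g : Equiv.Perm Dom} {n : ℤ} {φ : Circ → ZMod 3} (h : LampForm α g n φ)
    (a : ZMod 3) (x : Circ) : g.symm (a, x) =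
      (a - φ (x - ((n * α : ℝ) : Circ)), x - ((n * α : ℝ) : Circ)) := by
  rw [Equiv.symm_apply_eq, h]
  simp

lemma frm_mul {α : ℝ} {g h : Equiv.Perm Dom} {n m : ℤ} {φ χ : Circ → ZMod 3} (hg : LampForm α g n φ)
    (hh : LampForm α h m χ) : LampForm α (g * h) (n + m) (fun x => χ x + φ (x + ((m * α : ℝ) : Circ))) := by
  intro a x
  rw [Equiv.Perm.mul_apply, hh, hg]
  refine Prod.ext (by simp [add_assoc]) ?_
  simp only [add_assoc, ← AddCircle.coe_add]
  congr 2
  push_cast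
  ring

lemma frm_inv {α : ℝ} {g : Equiv.Perm Dom} {n : ℤ} {φ : Circ → ZMod 3} (h : LampForm α g n φ) :
    LampForm α g⁻¹ (-n) (fun x => - φ (x + (((-n : ℤ) * α : ℝ) : Circ))) := by
  intro a x
  rw [Equiv.Perm.inv_def, frm_symm h]
  simp [sub_eq_add_neg]

lemma frm_rot (α : ℝ) : LampForm α (rotR α) 1 (fun _ => 0) := by
  intro a x
  simp [rotR, circProj]

lemma frm_sigma (α : ℝ) : LampForm α lampSigma 0 (fun x => if x ∈ Iarc then 1 else 0) := by
  intro a x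
  by_cases h : x ∈ Iarc <;> simp [lampSigma, h]

lemma lamp_form {α : ℝ} {V : Submodule ℚ ℝ} (h1 : (1 : ℝ) ∈ V) (hα : α ∈ V)
    {g : Equiv.Perm Dom} (hg : g ∈ lampGroup α) :
    ∃ n : ℤ, ∃ φ : Circ → ZMod 3, Stp V φ ∧ LampForm α g n φ := by
  have hz : ∀ n : ℤ, (n * α : ℝ) ∈ V := fun n => by
    have := V.smul_mem (n : ℚ) hα
    simpa [Rat.smul_def] using this
  have hhalf : (1 / 2 : ℝ) ∈ V := by
    have := V.smul_mem (1 / 2 : ℚ) h1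
    simpa [Rat.smul_def] using this
  induction hg using Subgroup.closure_induction with
  | mem x hx =>
    rcases hx with rfl | rfl
    · exact ⟨1, _, stp_const V 0, frm_rot α⟩
    · refine ⟨0, _, ?_, frm_sigma α⟩
      exact stp_map (stp_arc V.zero_mem hhalf) (fun p : Prop => if p then (1 : ZMod 3) else 0)
  | one =>
    exact ⟨0, _, stp_const V 0, fun a x => by simp⟩
  | mul x y _ _ hx hy =>
    obtain ⟨n, φ, s1, f1⟩ := hx
    obtain ⟨m, χ, s2, f2⟩ := hy
    exact ⟨_, _, stp_map2 s2 (stp_translate s1 (hz m)) (fun a b => a + b), frm_mul f1 f2⟩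
  | inv x _ hx =>
    obtain ⟨n, φ, s1, f1⟩ := hx
    exact ⟨_, _, stp_map (stp_translate s1 (hz (-n))) (fun a => -a), frm_inv f1⟩

lemma rot_zero {α : ℝ} (hα : Irrational α) {n : ℤ} (h : ((n * α : ℝ) : Circ) = 0) : n = 0 := by
  by_contra hn
  have h0 : ((0 : ℝ) : Circ) = ((n * α : ℝ) : Circ) := by rw [h]; simp
  obtain ⟨k, hk⟩ := circ_eq_iff.1 h0
  exact (hα.intCast_mul hn).ne_int k (by simpa using hk)

lemma frm_cube {α : ℝ} {g : Equiv.Perm Dom} {φ : Circ → ZMod 3} (h : LampForm α g 0 φ) : g ^ 3 = 1 := by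
  ext1 ⟨a, x⟩
  have h' : ∀ a x, g (a, x) = (a + φ x, x) := fun a x => by simpa using h a x
  simp only [pow_succ, pow_zero, one_mul, Equiv.Perm.mul_apply, h', Equiv.Perm.one_apply]
  have : ∀ a c : ZMod 3, a + c + c + c = a := by decide
  rw [this]

lemma lamp_cube_form {α : ℝ} (hα : Irrational α) {g : Equiv.Perm Dom} {n : ℤ} {φ : Circ → ZMod 3}
    (h : LampForm α g n φ) (hg : g ^ 3 = 1) : n = 0 := by
  have f2 := frm_mul (frm_mul h h) h
  have e : g * g * g = 1 := by rw [← hg]; simp [pow_succ]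
  rw [e] at f2
  have := congrArg Prod.snd (f2 0 0)
  simp only [Equiv.Perm.one_apply, zero_add] at this
  have := rot_zero hα this.symm
  omega

lemma lamp_sq {α : ℝ} (hα : Irrational α) {g : Equiv.Perm Dom} (hgG : g ∈ lampGroup α)
    (hg : g ^ 2 = 1) : g = 1 := by
  obtain ⟨n, φ, -, h⟩ := lamp_form (V := ⊤) Submodule.mem_top Submodule.mem_top hgG
  have f2 := frm_mul h h
  rw [← pow_two, hg] at f2
  have h2 := congrArg Prod.snd (f2 0 0)
  simp only [Equiv.Perm.one_apply, zero_add] at h2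
  have h3 := rot_zero hα h2.symm
  have hn : n = 0 := by omega
  subst hn
  ext1 ⟨a, x⟩
  have h4 := congrArg Prod.fst (f2 0 x)
  rw [h]
  simp at h4
  have : ∀ c : ZMod 3, 0 = c + c → c = 0 := by decide
  simp [this _ h4]

/-! ### Non-constancy sets and commutators -/

def NS (f : Dom → ZMod 2) : Set Circ := {x | ∃ a b, f (a, x) ≠ f (b, x)}

def supL (g : Equiv.Perm Dom) : Set Circ := {x | (g (0, x)).1 ≠ 0}

def TT (g : Equiv.Perm Dom) (f : Dom → ZMod 2) : Dom → ZMod 2 := shiftF (ZMod 2) g f - f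

lemma dec1 : ∀ p : ZMod 3 → ZMod 2, ∀ c : ZMod 3,
    (∃ a b, p (a - c) - p a ≠ p (b - c) - p b) ↔ (∃ a b, p a ≠ p b) ∧ c ≠ 0 := by
  decide

lemma dec2 : ∀ p : ZMod 3 → ZMod 2, ∀ c : ZMod 3,
    (∃ a, p (a - c) - p a ≠ 0) ↔ (∃ a b, p a ≠ p b) ∧ c ≠ 0 := by
  decide

lemma supL_eq {α : ℝ} {g : Equiv.Perm Dom} {φ : Circ → ZMod 3} (h : LampForm α g 0 φ) :
    supL g = {x | φ x ≠ 0} := by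
  ext x
  simp [supL, h 0 x]

lemma TT_apply {α : ℝ} {g : Equiv.Perm Dom} {φ : Circ → ZMod 3} (h : LampForm α g 0 φ)
    (f : Dom → ZMod 2) (a : ZMod 3) (x : Circ) : TT g f (a, x) = f (a - φ x, x) - f (a, x) := by
  simp [TT, shiftF, frm_symm h]

lemma NS_TT {α : ℝ} {g : Equiv.Perm Dom} {φ : Circ → ZMod 3} (h : LampForm α g 0 φ)
    (f : Dom → ZMod 2) : NS (TT g f) = NS f ∩ supL g := by
  ext x
  rw [supL_eq h]
  simp only [NS, TT_apply h]
  exact dec1 (fun a => f (a, x)) (φ x)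

lemma TT_ne {α : ℝ} {g : Equiv.Perm Dom} {φ : Circ → ZMod 3} (h : LampForm α g 0 φ)
    (f : Dom → ZMod 2) : TT g f ≠ 0 ↔ (NS f ∩ supL g).Nonempty := by
  rw [supL_eq h, Function.ne_iff]
  constructor
  · rintro ⟨⟨a, x⟩, hx⟩
    rw [TT_apply h] at hx
    exact ⟨x, (dec2 (fun a => f (a, x)) (φ x)).1 ⟨a, hx⟩⟩
  · rintro ⟨x, hx⟩
    obtain ⟨a, ha⟩ := (dec2 (fun a => f (a, x)) (φ x)).2 hx
    exact ⟨(a, x), by rw [TT_apply h]; exact ha⟩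

lemma NS_shift {α : ℝ} {g : Equiv.Perm Dom} {n : ℤ} {φ : Circ → ZMod 3} (h : LampForm α g n φ)
    (f : Dom → ZMod 2) (x : Circ) :
    x ∈ NS (shiftF (ZMod 2) g f) ↔ x - ((n * α : ℝ) : Circ) ∈ NS f := by
  simp only [NS, shiftF, Set.mem_ofPred_eq, frm_symm h]
  constructor
  · rintro ⟨a, b, hab⟩
    exact ⟨_, _, hab⟩
  · rintro ⟨a, b, hab⟩
    refine ⟨a + φ (x - ((n * α : ℝ) : Circ)), b + φ (x - ((n * α : ℝ) : Circ)), ?_⟩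
    simpa using hab

lemma NS_shift_pow {α : ℝ} {g : Equiv.Perm Dom} {n : ℤ} {φ : Circ → ZMod 3} (h : LampForm α g n φ)
    (f : Dom → ZMod 2) (i : ℕ) : ∀ x : Circ,
    x ∈ NS (shiftF (ZMod 2) (g ^ i) f) ↔ x + i • ((-(n * α) : ℝ) : Circ) ∈ NS f := by
  induction i with
  | zero =>
    intro x
    have : shiftF (ZMod 2) (g ^ 0) f = f := by funext y; simp only [shiftF, pow_zero]; rfl
    rw [this]
    simp
  | succ i ih =>
    intro x
    have : shiftF (ZMod 2) (g ^ (i + 1)) f = shiftF (ZMod 2) g (shiftF (ZMod 2) (g ^ i) f) := by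
      funext y
      rw [pow_succ']
      rfl
    rw [this, NS_shift h, ih, succ_nsmul']
    rw [sub_eq_add_neg, add_assoc, AddCircle.coe_neg]

/-! ### Density and small arcs -/

lemma dense_pts {α : ℝ} (hα : Irrational α) {u v : ℝ} (huv : u < v) :
    ∃ n k : ℤ, u < n * α + k ∧ n * α + k < v := by
  have hd : Dense (AddSubgroup.closure {α, 1} : Set ℝ) := by
    rw [dense_addSubgroupClosure_pair_iff]; simpa using hα
  obtain ⟨y, hy, h⟩ := hd.exists_between huv
  obtain ⟨n, k, hnk⟩ := AddSubgroup.mem_closure_pair.1 hy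
  refine ⟨n, k, ?_⟩
  have : (n : ℝ) * α + k = y := by rw [← hnk]; simp
  rw [this]
  exact h

noncomputable def sig (α : ℝ) (m : ℤ) : ↥(lampGroup α) :=
  (⟨rotR α, Subgroup.subset_closure (by simp)⟩ : ↥(lampGroup α)) ^ m *
    ⟨lampSigma, Subgroup.subset_closure (by simp)⟩ *
    ((⟨rotR α, Subgroup.subset_closure (by simp)⟩ : ↥(lampGroup α)) ^ m)⁻¹

lemma rot_zpow (α : ℝ) (m : ℤ) : LampForm α (rotR α ^ m) m (fun _ => 0) := by
  induction m using Int.induction_on with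
  | zero => intro a x; simp
  | succ i ih =>
    rw [zpow_add_one]
    have := frm_mul ih (frm_rot α)
    simpa using this
  | pred i ih =>
    rw [zpow_sub_one]
    have := frm_mul ih (frm_inv (frm_rot α))
    simpa [sub_eq_add_neg] using this

lemma sig_frm (α : ℝ) (m : ℤ) : LampForm α (sig α m : Equiv.Perm Dom) 0
    (fun x => if x - ((m * α : ℝ) : Circ) ∈ Iarc then 1 else 0) := by
  have := frm_mul (frm_mul (rot_zpow α m) (frm_sigma α)) (frm_inv (rot_zpow α m))
  simpa [sig, sub_eq_add_neg] using this

lemma sig_cube (α : ℝ) (m : ℤ) : (sig α m) ^ 3 = 1 := by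
  apply Subtype.ext
  exact frm_cube (sig_frm α m)

lemma mem_supL_sig {α : ℝ} {m : ℤ} {x : ℝ} : (x : Circ) ∈ supL (sig α m : Equiv.Perm Dom) ↔
    ∃ k : ℤ, 0 ≤ x - m * α + k ∧ x - m * α + k < 1 / 2 := by
  rw [supL_eq (sig_frm α m), ← mem_arc]
  simp [Iarc, and_assoc]

lemma small_arc {α : ℝ} (hα : Irrational α) (x : ℝ) {ε : ℝ} (hε : 0 < ε) :
    ∃ m n : ℤ, (supL (sig α m : Equiv.Perm Dom) ∩ supL (sig α n : Equiv.Perm Dom)).Nonempty ∧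
      ∀ p ∈ supL (sig α m : Equiv.Perm Dom) ∩ supL (sig α n : Equiv.Perm Dom),
        ∃ y : ℝ, x ≤ y ∧ y < x + ε ∧ (y : Circ) = p := by
  set δ := min (ε / 2) (1 / 4) with hδ
  have d1 : δ ≤ ε / 2 := min_le_left _ _
  have d2 : δ ≤ 1 / 4 := min_le_right _ _
  have d0 : 0 < δ := by positivity
  obtain ⟨n, k, hc1, hc2⟩ := dense_pts hα (show 1 / 2 - δ < 1 / 2 by linarith)
  set c : ℝ := n * α + k with hc
  obtain ⟨m, l, ht1, ht2⟩ := dense_pts hα (show x - c < x - c + δ by linarith)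
  set t : ℝ := m * α + l with ht
  have key1 : ∀ y : ℝ, (y : Circ) ∈ supL (sig α m : Equiv.Perm Dom) ↔
      ∃ j : ℤ, t ≤ y + j ∧ y + j < t + 1 / 2 := by
    intro y
    rw [mem_supL_sig]
    constructor
    · rintro ⟨j, h1, h2⟩
      exact ⟨j + l, by push_cast; linarith, by push_cast; linarith⟩
    · rintro ⟨j, h1, h2⟩
      exact ⟨j - l, by push_cast; linarith, by push_cast; linarith⟩
  have key2 : ∀ y : ℝ, (y : Circ) ∈ supL (sig α (m + n) : Equiv.Perm Dom) ↔
      ∃ j : ℤ, t + c ≤ y + j ∧ y + j < t + c + 1 / 2 := by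
    intro y
    rw [mem_supL_sig]
    constructor
    · rintro ⟨j, h1, h2⟩
      push_cast at h1 h2
      exact ⟨j + l + k, by push_cast; linarith, by push_cast; linarith⟩
    · rintro ⟨j, h1, h2⟩
      exact ⟨j - l - k, by push_cast; linarith, by push_cast; linarith⟩
  refine ⟨m, m + n, ⟨((t + c : ℝ) : Circ), (key1 _).2 ⟨0, ?_, ?_⟩, (key2 _).2 ⟨0, ?_, ?_⟩⟩, ?_⟩
  · push_cast; linarith
  · push_cast; linarith
  · push_cast; linarith
  · push_cast; linarith
  · rintro p ⟨hp1, hp2⟩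
    obtain ⟨y, rfl⟩ := QuotientAddGroup.mk_surjective p
    obtain ⟨i, hi1, hi2⟩ := (key1 y).1 hp1
    obtain ⟨j, hj1, hj2⟩ := (key2 y).1 hp2
    have e : (j : ℝ) - i < 1 := by linarith
    have f : (-1 : ℝ) < (j : ℝ) - i := by linarith
    have e' : j - i < 1 := by exact_mod_cast e
    have f' : -1 < j - i := by exact_mod_cast f
    have : i = j := by omega
    subst this
    exact ⟨y + i, by linarith, by linarith, (circ_eq_iff.2 ⟨i, rfl⟩).symm⟩

/-! ### Splitting an isomorphism of semidirect products -/

lemma iso_split {N₁ N₂ G₁ G₂ : Type*} [CommGroup N₁] [CommGroup N₂] [Group G₁] [Group G₂]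
    {φ₁ : G₁ →* MulAut N₁} {φ₂ : G₂ →* MulAut N₂} (Ψ : N₁ ⋊[φ₁] G₁ ≃* N₂ ⋊[φ₂] G₂)
    (h1 : ∀ n : N₁, (Ψ (SemidirectProduct.inl n)).right = 1)
    (h2 : ∀ n : N₂, (Ψ.symm (SemidirectProduct.inl n)).right = 1) :
    ∃ (ψ : N₁ ≃* N₂) (θ : G₁ ≃* G₂), ∀ g n, ψ (φ₁ g n) = φ₂ (θ g) (ψ n) := by
  have i1 : ∀ n, Ψ (SemidirectProduct.inl n) =
      SemidirectProduct.inl (Ψ (SemidirectProduct.inl n)).left := fun n =>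
    SemidirectProduct.ext (by simp) (by simp [h1])
  have i2 : ∀ n, Ψ.symm (SemidirectProduct.inl n) =
      SemidirectProduct.inl (Ψ.symm (SemidirectProduct.inl n)).left := fun n =>
    SemidirectProduct.ext (by simp) (by simp [h2])
  have r1 : ∀ h, (Ψ h).right = (Ψ (SemidirectProduct.inr h.right)).right := fun h => by
    conv_lhs => rw [← SemidirectProduct.inl_left_mul_inr_right h]
    rw [map_mul, SemidirectProduct.mul_right, h1, one_mul]
  have r2 : ∀ h, (Ψ.symm h).right = (Ψ.symm (SemidirectProduct.inr h.right)).right := fun h => by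
    conv_lhs => rw [← SemidirectProduct.inl_left_mul_inr_right h]
    rw [map_mul, SemidirectProduct.mul_right, h2, one_mul]
  let ψ : N₁ ≃* N₂ :=
    { toFun := fun n => (Ψ (SemidirectProduct.inl n)).left
      invFun := fun n => (Ψ.symm (SemidirectProduct.inl n)).left
      left_inv := fun n => by
        beta_reduce
        rw [← i1, MulEquiv.symm_apply_apply, SemidirectProduct.left_inl]
      right_inv := fun n => by
        beta_reduce
        rw [← i2, MulEquiv.apply_symm_apply, SemidirectProduct.left_inl]
      map_mul' := fun a b => by
        rw [map_mul, map_mul, SemidirectProduct.mul_left, h1]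
        simp }
  let θ : G₁ ≃* G₂ :=
    { toFun := fun g => (Ψ (SemidirectProduct.inr g)).right
      invFun := fun g => (Ψ.symm (SemidirectProduct.inr g)).right
      left_inv := fun g => by
        beta_reduce
        rw [← r2, MulEquiv.symm_apply_apply, SemidirectProduct.right_inr]
      right_inv := fun g => by
        beta_reduce
        rw [← r1, MulEquiv.apply_symm_apply, SemidirectProduct.right_inr]
      map_mul' := fun a b => by
        rw [map_mul, map_mul, SemidirectProduct.mul_right] }
  have hψ : ∀ n, Ψ (SemidirectProduct.inl n) = SemidirectProduct.inl (ψ n) := i1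
  refine ⟨ψ, θ, fun g n => ?_⟩
  apply SemidirectProduct.inl_injective (φ := φ₂)
  have hg : Ψ (SemidirectProduct.inr g) = SemidirectProduct.inl (Ψ (SemidirectProduct.inr g)).left *
      SemidirectProduct.inr (θ g) := (SemidirectProduct.inl_left_mul_inr_right _).symm
  have k : (SemidirectProduct.inr (θ g) * SemidirectProduct.inl (ψ n) *
      (SemidirectProduct.inr (θ g))⁻¹ : N₂ ⋊[φ₂] G₂) =
      SemidirectProduct.inl (φ₂ (θ g) (ψ n)) := by
    rw [SemidirectProduct.inl_aut, map_inv SemidirectProduct.inr (θ g)]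
  have k1 : Ψ (SemidirectProduct.inl (φ₁ g n)) =
      Ψ (SemidirectProduct.inr g) * SemidirectProduct.inl (ψ n) *
        (Ψ (SemidirectProduct.inr g))⁻¹ := by
    rw [SemidirectProduct.inl_aut, map_mul, map_mul, hψ, map_inv SemidirectProduct.inr g,
      map_inv Ψ]
  rw [← hψ, k1, hg]
  set u := (Ψ (SemidirectProduct.inr g)).left
  have e : (SemidirectProduct.inl u * SemidirectProduct.inr (θ g)) * SemidirectProduct.inl (ψ n) *
      (SemidirectProduct.inl u * SemidirectProduct.inr (θ g))⁻¹ =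
      SemidirectProduct.inl u * (SemidirectProduct.inr (θ g) * SemidirectProduct.inl (ψ n) *
        (SemidirectProduct.inr (θ g))⁻¹) * (SemidirectProduct.inl u : N₂ ⋊[φ₂] G₂)⁻¹ := by
    simp only [mul_assoc, mul_inv_rev]
  rw [e, k, ← map_mul SemidirectProduct.inl, mul_comm u, map_mul SemidirectProduct.inl,
    mul_assoc, mul_inv_cancel, mul_one]

/-! ### The module `F_J` -/

noncomputable abbrev FJ (α a b : ℝ) : AddSubgroup (Dom → ZMod 2) :=
  genInvSubgroup (ZMod 2) (lampGroup α) {(arcJ a b).indicator fun _ => (1 : ZMod 2)}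

lemma arc_mem_FJ (α a b : ℝ) : ((arcJ a b).indicator fun _ => (1 : ZMod 2)) ∈ FJ α a b := by
  refine AddSubgroup.mem_sInf.2 ?_
  intro K hK
  exact hK.1 rfl

lemma FJ_stp {α a b : ℝ} {V : Submodule ℚ ℝ} (h1 : (1 : ℝ) ∈ V) (hα : α ∈ V) (ha : a ∈ V)
    (hb : b ∈ V) {f : Dom → ZMod 2} (hf : f ∈ FJ α a b) :
    Stp V (fun x => fun c : ZMod 3 => f (c, x)) := by
  have hz : ∀ n : ℤ, (n * α : ℝ) ∈ V := fun n => by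
    have := V.smul_mem (n : ℚ) hα
    simpa [Rat.smul_def] using this
  let K : AddSubgroup (Dom → ZMod 2) :=
    { carrier := {f | Stp V (fun x => fun c : ZMod 3 => f (c, x))}
      zero_mem' := by
        rw [Set.mem_ofPred_eq]
        exact stp_const V (fun _ : ZMod 3 => (0 : ZMod 2))
      add_mem' := fun {f g} hf hg => by
        rw [Set.mem_ofPred_eq] at *
        exact stp_map2 hf hg (fun p q => p + q)
      neg_mem' := fun {f} hf => by
        rw [Set.mem_ofPred_eq] at *
        exact stp_map hf (fun p => -p) }
  have : FJ α a b ≤ K := by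
    refine sInf_le ⟨?_, ?_⟩
    · rintro _ rfl
      change Stp V (fun x => fun c : ZMod 3 => (arcJ a b).indicator (fun _ => (1 : ZMod 2)) (c, x))
      have := stp_map (stp_arc ha hb)
        (fun p : Prop => fun c : ZMod 3 => if c = 0 ∧ p then (1 : ZMod 2) else 0)
      refine cast ?_ this
      congr 1
      funext x c
      simp [arcJ, Set.indicator_apply]
    · intro g hg f hf
      change Stp V (fun x => fun c : ZMod 3 => shiftF (ZMod 2) g f (c, x))
      replace hf : Stp V (fun x => fun c : ZMod 3 => f (c, x)) := hf
      obtain ⟨n, φ, hs, hform⟩ := lamp_form h1 hα hg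
      have := stp_translate (stp_map2 hs hf (fun t p => fun c : ZMod 3 => p (c - t)))
        (V.neg_mem (hz n))
      refine cast ?_ this
      congr 1
      funext x c
      simp [shiftF, frm_symm hform, sub_eq_add_neg]
  exact this hf

lemma FJ_NS_stp {α a b : ℝ} {V : Submodule ℚ ℝ} (h1 : (1 : ℝ) ∈ V) (hα : α ∈ V) (ha : a ∈ V)
    (hb : b ∈ V) {f : Dom → ZMod 2} (hf : f ∈ FJ α a b) : Stp V (fun x => x ∈ NS f) :=
  stp_map (FJ_stp h1 hα ha hb hf) (fun p : ZMod 3 → ZMod 2 => ∃ a b, p a ≠ p b)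

lemma NS_arc (a b : ℝ) : NS ((arcJ a b).indicator fun _ => (1 : ZMod 2)) =
    circProj '' Set.Ico a b := by
  ext x
  have key : ∀ c : ZMod 3, (arcJ a b).indicator (fun _ => (1 : ZMod 2)) (c, x) =
      if c = 0 ∧ x ∈ circProj '' Set.Ico a b then 1 else 0 := fun c => by
    simp [arcJ, Set.indicator_apply]
  simp only [NS, Set.mem_ofPred_eq, key]
  by_cases h : x ∈ circProj '' Set.Ico a b
  · simp only [h, and_true, iff_true]
    exact ⟨0, 1, by decide⟩
  · simp [h]

section FJmod

variable {α a b : ℝ}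

noncomputable def gact (g : ↥(lampGroup α)) (f : ↥(FJ α a b)) : ↥(FJ α a b) :=
  ⟨shiftF (ZMod 2) g f.1, shift_mem_genInvSubgroup _ _ _ g.2 f.2⟩

noncomputable def TF (g : ↥(lampGroup α)) (f : ↥(FJ α a b)) : ↥(FJ α a b) := gact g f - f

noncomputable def TW (w : List ↥(lampGroup α)) (f : ↥(FJ α a b)) : ↥(FJ α a b) := w.foldr TF f

def ZW (w : List ↥(lampGroup α)) : Set Circ := {x | ∀ g ∈ w, x ∈ supL (g : Equiv.Perm Dom)}

lemma cube_form {V : Submodule ℚ ℝ} (h1 : (1 : ℝ) ∈ V) (hαV : α ∈ V) (hα : Irrational α)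
    {g : ↥(lampGroup α)} (hg : g ^ 3 = 1) :
    ∃ φ, Stp V φ ∧ LampForm α (g : Equiv.Perm Dom) 0 φ := by
  obtain ⟨n, φ, hs, hf⟩ := lamp_form h1 hαV g.2
  have : n = 0 := lamp_cube_form hα hf (congrArg Subtype.val hg)
  subst this
  exact ⟨φ, hs, hf⟩

lemma NS_TW (hα : Irrational α) (w : List ↥(lampGroup α)) (hw : ∀ g ∈ w, g ^ 3 = 1)
    (f : ↥(FJ α a b)) : NS (TW w f).1 = NS f.1 ∩ ZW w := by
  induction w with
  | nil => simp [TW, ZW]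
  | cons g w ih =>
    obtain ⟨φ, -, hf⟩ := cube_form (V := ⊤) Submodule.mem_top Submodule.mem_top hα
      (hw g (by simp))
    have h1 := NS_TT hf (TW w f).1
    have h2 : (TW (g :: w) f).1 = TT g (TW w f).1 := rfl
    rw [h2, h1, ih fun g hg => hw g (by simp [hg])]
    ext x
    simp [ZW]
    tauto

lemma TW_ne (hα : Irrational α) {w : List ↥(lampGroup α)} (hw0 : w ≠ [])
    (hw : ∀ g ∈ w, g ^ 3 = 1) (f : ↥(FJ α a b)) : TW w f ≠ 0 ↔ (NS f.1 ∩ ZW w).Nonempty := by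
  cases w with
  | nil => exact absurd rfl hw0
  | cons g w =>
    obtain ⟨φ, -, hf⟩ := cube_form (V := ⊤) Submodule.mem_top Submodule.mem_top hα
      (hw g (by simp))
    have h1 := TT_ne hf (TW w f).1
    have h2 : (TW (g :: w) f).1 = TT g (TW w f).1 := rfl
    have h3 : TW (g :: w) f ≠ 0 ↔ (TW (g :: w) f).1 ≠ 0 := by simp
    rw [h3, h2, h1, NS_TW hα w fun g hg => hw g (by simp [hg])]
    have : NS f.1 ∩ ZW w ∩ supL (g : Equiv.Perm Dom) = NS f.1 ∩ ZW (g :: w) := by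
      ext x
      simp [ZW]
      tauto
    rw [this]

lemma ZW_append (w w' : List ↥(lampGroup α)) : ZW (w ++ w') = ZW w ∩ ZW w' := by
  ext x
  simp only [ZW, List.mem_append, Set.mem_inter_iff, Set.mem_ofPred_eq]
  constructor
  · intro h; exact ⟨fun g hg => h g (Or.inl hg), fun g hg => h g (Or.inr hg)⟩
  · rintro ⟨h, h'⟩ g (hg | hg)
    exacts [h g hg, h' g hg]

lemma ZW_right (hα : Irrational α) {w : List ↥(lampGroup α)} (hw : ∀ g ∈ w, g ^ 3 = 1) :
    Stp ⊤ (fun x => x ∈ ZW w) := by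
  induction w with
  | nil => simpa [ZW] using stp_const ⊤ True
  | cons g w ih =>
    obtain ⟨φ, hs, hf⟩ := cube_form (V := ⊤) Submodule.mem_top Submodule.mem_top hα
      (hw g (by simp))
    have := stp_map2 hs (ih fun g hg => hw g (by simp [hg])) (fun c p => c ≠ 0 ∧ p)
    refine cast ?_ this
    congr 1
    funext x
    have e : x ∈ supL (g : Equiv.Perm Dom) ↔ φ x ≠ 0 := by rw [supL_eq hf]; rfl
    simp only [ZW, List.mem_cons, forall_eq_or_imp, Set.mem_ofPred_eq, e]

/-- Every point lies in the non-constancy set of some element of `F_J`. -/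
lemma exists_NS (hα : Irrational α) (hab : a < b) (p : Circ) : ∃ f : ↥(FJ α a b), p ∈ NS f.1 := by
  obtain ⟨x, rfl⟩ := QuotientAddGroup.mk_surjective p
  obtain ⟨n, k, h1, h2⟩ := dense_pts hα (show x - b < x - a by linarith)
  let r : ↥(lampGroup α) := ⟨rotR α, Subgroup.subset_closure (by simp)⟩
  refine ⟨gact (r ^ n) ⟨_, arc_mem_FJ α a b⟩, ?_⟩
  have := NS_shift (rot_zpow α n) ((arcJ a b).indicator fun _ => (1 : ZMod 2)) (x : Circ)
  refine this.2 ?_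
  rw [NS_arc, ← AddCircle.coe_sub, mem_arc]
  exact ⟨-k, by push_cast; linarith, by push_cast; linarith⟩

end FJmod

lemma main_le {α a₁ b₁ a₂ b₂ : ℝ} (hα : Irrational α) (hab : a₂ < b₂)
    (ψ : ↥(FJ α a₁ b₁) ≃+ ↥(FJ α a₂ b₂)) (θ : ↥(lampGroup α) ≃* ↥(lampGroup α))
    (hψ : ∀ g f, ψ (gact g f) = gact (θ g) (ψ f)) (f : ↥(FJ α a₁ b₁)) :
    (volume (NS f.1)).toReal ≤ (volume (NS (ψ f).1)).toReal := by
  have hT : ∀ (w : List ↥(lampGroup α)) f, ψ (TW w f) = TW (w.map θ) (ψ f) := by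
    intro w f
    induction w with
    | nil => rfl
    | cons g w ih =>
      change ψ (gact g (TW w f) - TW w f) = gact (θ g) (TW (w.map θ) (ψ f)) - TW (w.map θ) (ψ f)
      rw [map_sub, hψ, ih]
  have hTne : ∀ (w : List ↥(lampGroup α)) f, TW w f ≠ 0 ↔ TW (w.map θ) (ψ f) ≠ 0 := by
    intro w f
    rw [← hT, Ne, Ne, map_eq_zero_iff ψ ψ.injective]
  let r : ↥(lampGroup α) := ⟨rotR α, Subgroup.subset_closure (by simp)⟩
  obtain ⟨e, φ, -, hform⟩ := lamp_form (V := ⊤) Submodule.mem_top Submodule.mem_top (θ r).2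
  have he : e ≠ 0 := by
    rintro rfl
    have h3 : (θ r) ^ 3 = 1 := Subtype.ext (frm_cube hform)
    rw [← map_pow, map_eq_one_iff θ θ.injective] at h3
    have := lamp_cube_form hα (frm_rot α) (congrArg Subtype.val h3)
    omega
  have hγ : Irrational (-((e : ℝ) * α)) := (hα.intCast_mul he).neg
  have top : ∀ x : ℝ, x ∈ (⊤ : Submodule ℚ ℝ) := fun _ => Submodule.mem_top
  refine measure_le_of_pattern (β := -((1 : ℤ) * α)) hγ
    (stp_meas (FJ_NS_stp (top 1) (top α) (top a₁) (top b₁) f.2))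
    (stp_closure_vol (FJ_NS_stp (top 1) (top α) (top a₂) (top b₂) (ψ f).2)) ?_
  rintro S ⟨p, hp⟩
  rcases S.eq_empty_or_nonempty with rfl | hS
  · exact ⟨0, by simp⟩
  obtain ⟨x, rfl⟩ := QuotientAddGroup.mk_surjective p
  have hp' : ∀ i ∈ S, (x : Circ) ∈ NS (gact (r ^ i) f).1 := fun i hi =>
    (NS_shift_pow (frm_rot α) f.1 i _).2 (hp i hi)
  have hε : ∃ ε > 0, ∀ y : ℝ, x ≤ y → y < x + ε → ∀ i ∈ S, (y : Circ) ∈ NS (gact (r ^ i) f).1 := by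
    have hst : ∀ i, ∃ ε > 0, ∀ y : ℝ, x ≤ y → y < x + ε →
        ((y : Circ) ∈ NS (gact (r ^ i) f).1) = ((x : Circ) ∈ NS (gact (r ^ i) f).1) := fun i =>
      stp_right (FJ_NS_stp (top 1) (top α) (top a₁) (top b₁) (gact (r ^ i) f).2) x
    choose ε hε0 hε using hst
    refine ⟨S.inf' hS ε, ?_, fun y h1 h2 i hi => ?_⟩
    · rw [gt_iff_lt, Finset.lt_inf'_iff]; exact fun i _ => hε0 i
    · rw [hε i y h1 (h2.trans_le (by gcongr; exact Finset.inf'_le _ hi))]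
      exact hp' i hi
  obtain ⟨ε, hε0, hε⟩ := hε
  obtain ⟨m, n, hne, hsub⟩ := small_arc hα x hε0
  let w : List ↥(lampGroup α) := [sig α m, sig α n]
  have hw : ∀ g ∈ w, g ^ 3 = 1 := by
    intro g hg
    simp only [w, List.mem_cons, List.not_mem_nil, or_false] at hg
    rcases hg with rfl | rfl <;> exact sig_cube _ _
  have hZ : ∀ m n : ℤ, ZW [sig α m, sig α n] =
      supL (sig α m : Equiv.Perm Dom) ∩ supL (sig α n : Equiv.Perm Dom) := fun m n => by
    ext y; simp [ZW]
  have hZw : ∀ i ∈ S, ZW w ⊆ NS (gact (r ^ i) f).1 := by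
    intro i hi p hp
    rw [hZ] at hp
    obtain ⟨y, h1, h2, rfl⟩ := hsub p hp
    exact hε y h1 h2 i hi
  have hw' : ∀ g ∈ w.map θ, g ^ 3 = 1 := by
    intro g hg
    obtain ⟨g', hg', rfl⟩ := List.mem_map.1 hg
    rw [← map_pow, hw g' hg', map_one]
  obtain ⟨i₀, hi₀⟩ := hS
  have hne2 : (ZW (w.map θ)).Nonempty := by
    obtain ⟨p, hp⟩ := hne
    rw [← hZ] at hp
    have := (TW_ne hα (w := w) (by simp [w]) hw (gact (r ^ i₀) f)).2 ⟨p, hZw i₀ hi₀ hp, hp⟩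
    rw [hTne, TW_ne hα (by simp [w]) hw'] at this
    exact this.mono Set.inter_subset_right
  obtain ⟨q, hq⟩ := hne2
  refine ⟨q, fun i hi => ?_⟩
  have hgoal : q ∈ NS (gact (θ (r ^ i)) (ψ f)).1 := by
    by_contra hcon
    obtain ⟨y, rfl⟩ := QuotientAddGroup.mk_surjective q
    obtain ⟨ε₁, h₁0, h₁⟩ := stp_right (ZW_right hα hw') y
    obtain ⟨ε₂, h₂0, h₂⟩ := stp_right
      (FJ_NS_stp (top 1) (top α) (top a₂) (top b₂) (gact (θ (r ^ i)) (ψ f)).2) y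
    obtain ⟨m', n', ⟨p, hp⟩, hsub'⟩ := small_arc hα y (lt_min h₁0 h₂0)
    let v : List ↥(lampGroup α) := [θ.symm (sig α m'), θ.symm (sig α n')]
    have hv : v.map θ = [sig α m', sig α n'] := by simp [v]
    have hpz : p ∈ ZW (v.map θ) := by rw [hv, hZ]; exact hp
    have hvw : ∀ g ∈ (v ++ w).map θ, g ^ 3 = 1 := by
      intro g hg
      rw [List.map_append, List.mem_append, hv] at hg
      rcases hg with hg | hg
      · simp only [List.mem_cons, List.not_mem_nil, or_false] at hg
        rcases hg with rfl | rfl <;> exact sig_cube _ _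
      · exact hw' g hg
    have hvw0 : ∀ g ∈ v ++ w, g ^ 3 = 1 := by
      intro g hg
      have := hvw (θ g) (List.mem_map_of_mem hg)
      rwa [← map_pow, map_eq_one_iff θ θ.injective] at this
    obtain ⟨g, hg⟩ := exists_NS (α := α) hα hab p
    have t1 : TW ((v ++ w).map θ) g ≠ 0 := by
      refine (TW_ne hα (by simp [w]) hvw g).2 ⟨p, hg, ?_⟩
      rw [List.map_append, ZW_append]
      refine ⟨hpz, ?_⟩
      obtain ⟨z, hz1, hz2, rfl⟩ := hsub' p hp
      have := h₁ z hz1 (hz2.trans_le (by gcongr; exact min_le_left _ _))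
      exact cast this.symm hq
    obtain ⟨g, rfl⟩ := ψ.surjective g
    rw [← hTne, TW_ne hα (by simp [w]) hvw0] at t1
    obtain ⟨z, -, hz⟩ := t1
    have t2 : TW (v ++ w) (gact (r ^ i) f) ≠ 0 := by
      refine (TW_ne hα (by simp [w]) hvw0 _).2 ⟨z, ?_, hz⟩
      rw [ZW_append] at hz
      exact hZw i hi hz.2
    rw [hTne, TW_ne hα (by simp [w]) hvw, hψ] at t2
    obtain ⟨p', hp'1, hp'2⟩ := t2
    rw [List.map_append, ZW_append, hv, hZ] at hp'2
    obtain ⟨z, hz1, hz2, rfl⟩ := hsub' p' hp'2.1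
    have := h₂ z hz1 (hz2.trans_le (by gcongr; exact min_le_right _ _))
    exact hcon (cast this hp'1)
  rw [map_pow] at hgoal
  exact (NS_shift_pow hform (ψ f).1 i q).1 hgoal

lemma right_eq_one {α a₁ b₁ a₂ b₂ : ℝ} (hα : Irrational α)
    (Ψ : lampLighterLighter α (arcJ a₁ b₁) ≃* lampLighterLighter α (arcJ a₂ b₂))
    (n : Multiplicative ↥(FJ α a₁ b₁)) : (Ψ (SemidirectProduct.inl n)).right = 1 := by
  have hn : n ^ 2 = 1 := by
    apply Multiplicative.toAdd.injective
    apply Subtype.ext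
    funext x
    change (2 • ((Multiplicative.toAdd n).1)) x = 0
    simp only [Pi.smul_apply]
    exact CharTwo.two_nsmul _
  have h : (Ψ (SemidirectProduct.inl n)) ^ 2 = 1 := by
    rw [← map_pow, ← map_pow, hn, map_one, map_one]
  have h2 := congrArg SemidirectProduct.rightHom h
  rw [map_pow, map_one] at h2
  apply Subtype.ext
  exact lamp_sq hα (Subtype.prop _) (congrArg Subtype.val h2)

/-- If `H_{J₁} ≅ H_{J₂}` for arcs `J_i = {0} × π([a_i, b_i))` of length `< 1/2`, then the
length `b₁ - a₁` lies in the `ℚ`-vector space spanned by `1, α, a₂, b₂`. -/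
theorem length_mem_span_of_iso
    (α : ℝ) (hα : Irrational α)
    (a₁ b₁ a₂ b₂ : ℝ) (h1 : a₁ < b₁) (h2 : a₂ < b₂)
    (hl1 : b₁ - a₁ < 1 / 2) (hl2 : b₂ - a₂ < 1 / 2)
    (hiso : Nonempty
      (lampLighterLighter α (arcJ a₁ b₁) ≃* lampLighterLighter α (arcJ a₂ b₂))) :
    b₁ - a₁ ∈ Submodule.span ℚ ({1, α, a₂, b₂} : Set ℝ) := by
  obtain ⟨Ψ⟩ := hiso
  obtain ⟨ψ, θ, hψ⟩ := iso_split Ψ (right_eq_one hα Ψ) (right_eq_one hα Ψ.symm)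
  let ψ' : ↥(FJ α a₁ b₁) ≃+ ↥(FJ α a₂ b₂) := MulEquiv.toAdditive ψ
  have hψ' : ∀ g f, ψ' (gact g f) = gact (θ g) (ψ' f) := fun g f => hψ g f
  have hψs : ∀ g f, ψ'.symm (gact g f) = gact (θ.symm g) (ψ'.symm f) := fun g f => by
    rw [AddEquiv.symm_apply_eq, hψ']
    simp
  let f : ↥(FJ α a₁ b₁) := ⟨_, arc_mem_FJ α a₁ b₁⟩
  have l1 := main_le hα h2 ψ' θ hψ' f
  have l2 := main_le hα h1 ψ'.symm θ.symm hψs (ψ' f)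
  rw [AddEquiv.symm_apply_apply] at l2
  have hf : (volume (NS f.1)).toReal = b₁ - a₁ := by
    rw [← arc_measure h1.le (by linarith), ← NS_arc]
  rw [← hf, le_antisymm l1 l2]
  have hs : ∀ x ∈ ({1, α, a₂, b₂} : Set ℝ), x ∈ Submodule.span ℚ ({1, α, a₂, b₂} : Set ℝ) :=
    fun x hx => Submodule.subset_span hx
  have m1 := hs 1 (by simp)
  exact stp_measure m1 (FJ_NS_stp m1 (hs α (by simp)) (hs a₂ (by simp)) (hs b₂ (by simp)) (ψ' f).2)
end

section
/- Let G be a finitely generated subgroup of IET. Then there exists a unique finite (possibly empty) collection I₁,…,I_r of pairwise disjoint G-invariant subdomains of [0,1) such that: (i) for each i, every G-orbit of a point of I_i is dense in I_i; and (ii) the complement [0,1) ∖ (I₁ ∪ … ∪ I_r) is G-invariant and the group formed by the restrictions of the elements of G to this complement is finite. -/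
abbrev I01 : Set ℝ := Set.Ico (0 : ℝ) 1

def IsIET (T : Equiv.Perm I01) : Prop :=
  ∃ (n : ℕ) (a : Fin (n + 1) → ℝ), StrictMono a ∧ a 0 = 0 ∧ a (Fin.last n) = 1 ∧
    ∀ i : Fin n, ∃ c : ℝ, ∀ x : I01, (x : ℝ) ∈ Set.Ico (a i.castSucc) (a i.succ) →
      ((T x : ℝ)) = (x : ℝ) + c

/-- A subdomain of `[0,1)`: a nonempty finite union of half-open intervals `[a,b)`
with `0 ≤ a < b ≤ 1`. -/
def IsSubdomain (J : Set I01) : Prop :=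
  J.Nonempty ∧ ∃ F : Finset (ℝ × ℝ),
    (∀ p ∈ F, 0 ≤ p.1 ∧ p.1 < p.2 ∧ p.2 ≤ 1) ∧
    ∀ x : I01, x ∈ J ↔ ∃ p ∈ F, (x : ℝ) ∈ Set.Ico p.1 p.2

/-- A subset `J` of `[0,1)` is invariant under a bijection `g` of `[0,1)`. -/
def InvariantUnder (g : Equiv.Perm I01) (J : Set I01) : Prop :=
  ∀ x, g x ∈ J ↔ x ∈ J


namespace IETaux

open Set Filter Topology

/-- `g` is a translation between consecutive points of `D`. -/
def Tame (D : Finset ℝ) (g : Equiv.Perm I01) : Prop :=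
  ∀ x y : I01, (x : ℝ) ≤ y → (∀ d ∈ D, ¬ ((x : ℝ) < d ∧ d ≤ y)) → (g y : ℝ) - g x = y - x

/-- finite union of half-open intervals, in terms of breakpoints. -/
def FUP (J : Set I01) : Prop :=
  ∃ P : Finset ℝ, ∀ x y : I01, (x : ℝ) ≤ y → (∀ d ∈ P, ¬ ((x : ℝ) < d ∧ d ≤ y)) → (x ∈ J ↔ y ∈ J)

def Orb (G : Subgroup (Equiv.Perm I01)) (x : I01) : Set I01 := {y | ∃ g ∈ G, g x = y}

def Fin' (G : Subgroup (Equiv.Perm I01)) : Set I01 := {x | (Orb G x).Finite}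

def rcl (G : Subgroup (Equiv.Perm I01)) (x : I01) : Set I01 :=
  {y | ∀ ε > 0, ∃ z ∈ Orb G x, (y : ℝ) ≤ z ∧ (z : ℝ) < y + ε}

def Gap (A : Set I01) (t : ℝ) : Set I01 :=
  {x | ∃ u : ℝ, 0 ≤ u ∧ u + t ≤ 1 ∧ u ≤ x ∧ (x : ℝ) < u + t ∧ ∀ a ∈ A, ¬ (u < a ∧ (a : ℝ) < u + t)}

theorem exists_tame {g : Equiv.Perm I01} (h : IsIET g) : ∃ D : Finset ℝ, Tame D g := by
  obtain ⟨n, a, ha, h0, h1, h⟩ := h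
  refine ⟨Finset.univ.image a, fun x y hxy hd => ?_⟩
  have key : ∃ i : Fin n, (x : ℝ) ∈ Ico (a i.castSucc) (a i.succ) := by
    by_contra hcon
    push Not at hcon
    have : ∀ k : Fin (n + 1), a k ≤ x := by
      intro k
      induction k using Fin.induction with
      | zero => rw [h0]; exact x.2.1
      | succ i ih =>
        by_contra hlt
        exact hcon i ⟨ih, not_le.1 hlt⟩
    have := this (Fin.last n)
    rw [h1] at this
    exact absurd x.2.2 (not_lt.2 this)
  obtain ⟨i, hi⟩ := key
  obtain ⟨c, hc⟩ := h i
  have hy : (y : ℝ) ∈ Ico (a i.castSucc) (a i.succ) := by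
    refine ⟨hi.1.trans hxy, ?_⟩
    by_contra hlt
    exact hd (a i.succ) (by simp) ⟨hi.2, not_lt.1 hlt⟩
  rw [hc x hi, hc y hy]; ring

theorem Tame.mono {D D' : Finset ℝ} (h : D ⊆ D') {g : Equiv.Perm I01} (hg : Tame D g) : Tame D' g :=
  fun x y hxy hd => hg x y hxy fun d hdD => hd d (h hdD)

theorem Orb.self (G : Subgroup (Equiv.Perm I01)) (x : I01) : x ∈ Orb G x := ⟨1, G.one_mem, rfl⟩

theorem Orb.smul {G : Subgroup (Equiv.Perm I01)} {x y : I01} {g : Equiv.Perm I01} (hg : g ∈ G)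
    (h : y ∈ Orb G x) : g y ∈ Orb G x := by
  obtain ⟨k, hk, rfl⟩ := h
  exact ⟨g * k, G.mul_mem hg hk, rfl⟩

theorem Orb.eq {G : Subgroup (Equiv.Perm I01)} {x y : I01}
    (h : y ∈ Orb G x) : Orb G y = Orb G x := by
  obtain ⟨k, hk, rfl⟩ := h
  ext z
  constructor
  · rintro ⟨g, hg, rfl⟩
    exact ⟨g * k, G.mul_mem hg hk, rfl⟩
  · rintro ⟨g, hg, rfl⟩
    exact ⟨g * k⁻¹, G.mul_mem hg (G.inv_mem hk), by simp⟩

theorem Fin'.inv {G : Subgroup (Equiv.Perm I01)} {x : I01} {g : Equiv.Perm I01} (hg : g ∈ G) :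
    g x ∈ Fin' G ↔ x ∈ Fin' G := by
  unfold Fin'
  simp only [mem_ofPred_eq]
  rw [Orb.eq (Orb.smul hg (Orb.self G x))]

/-- The setup: finite generating set with break set. -/
structure Setup (G : Subgroup (Equiv.Perm I01)) (T : Finset (Equiv.Perm I01)) (D : Finset ℝ) :
    Prop where
  cl : Subgroup.closure (T : Set (Equiv.Perm I01)) = G
  tame : ∀ g ∈ T, Tame D g ∧ Tame D g⁻¹
  zero : (0 : ℝ) ∈ D
  one : (1 : ℝ) ∈ D
  sub : ∀ d ∈ D, 0 ≤ d ∧ d ≤ 1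

theorem exists_setup (G : Subgroup (Equiv.Perm I01)) (hG : ∀ g ∈ G, IsIET g) (hfg : Group.FG ↥G) :
    ∃ T D, Setup G T D := by
  classical
  rw [Group.fg_iff_subgroup_fg] at hfg
  obtain ⟨T, hT⟩ := hfg
  have hTG : ∀ g ∈ T, g ∈ G := fun g hg => hT ▸ Subgroup.subset_closure hg
  have h1 : ∀ g : Equiv.Perm I01, ∃ D : Finset ℝ, g ∈ T → Tame D g ∧ Tame D g⁻¹ := by
    intro g
    by_cases hg : g ∈ T
    · obtain ⟨D1, h1⟩ := exists_tame (hG g (hTG g hg))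
      obtain ⟨D2, h2⟩ := exists_tame (hG g⁻¹ (G.inv_mem (hTG g hg)))
      exact ⟨D1 ∪ D2, fun _ => ⟨h1.mono Finset.subset_union_left, h2.mono Finset.subset_union_right⟩⟩
    · exact ⟨∅, fun h => absurd h hg⟩
  choose D hD using h1
  have hres : ∀ (D : Finset ℝ) g, Tame D g → Tame (insert 0 (insert 1 (D.filter fun d => 0 ≤ d ∧ d ≤ 1))) g := by
    intro D g hg x y hxy hd
    refine hg x y hxy fun d hdD hh => hd d ?_ hh
    simp only [Finset.mem_insert, Finset.mem_filter]
    exact Or.inr (Or.inr ⟨hdD, x.2.1.trans hh.1.le, hh.2.trans y.2.2.le⟩)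
  refine ⟨T, insert 0 (insert 1 ((T.biUnion D).filter fun d => 0 ≤ d ∧ d ≤ 1)), hT, ?_, by simp,
    by simp, ?_⟩
  · intro g hg
    have := Finset.subset_biUnion_of_mem D hg
    exact ⟨hres _ _ ((hD g hg).1.mono this), hres _ _ ((hD g hg).2.mono this)⟩
  · intro d hd
    simp only [Finset.mem_insert, Finset.mem_filter] at hd
    rcases hd with rfl | rfl | h
    · simp
    · simp
    · exact h.2

theorem sep_finite {X : Set I01} {δ : ℝ} (hδ : 0 < δ)
    (h : ∀ z ∈ X, ∀ z' ∈ X, (z : ℝ) < z' → (z : ℝ) + δ ≤ z') : X.Finite := by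
  refine Set.Finite.of_injOn (f := fun z : I01 => ⌊(z : ℝ) / δ⌋₊) (t := Set.Iic ⌊1 / δ⌋₊)
    ?_ ?_ (Set.finite_Iic _)
  · intro z hz
    exact Nat.floor_le_floor (by gcongr; exact z.2.2.le)
  · have key : ∀ z ∈ X, ∀ z' ∈ X, (z : ℝ) < z' → ⌊(z : ℝ) / δ⌋₊ ≠ ⌊(z' : ℝ) / δ⌋₊ := by
      intro z hz z' hz' hlt heq
      have h1 := h z hz z' hz' hlt
      have h2 : (z : ℝ) / δ + 1 ≤ z' / δ := by
        rw [div_add_one hδ.ne']; gcongr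
      have h3 := Nat.floor_le (div_nonneg z.2.1 hδ.le)
      have h4 := Nat.lt_floor_add_one ((z' : ℝ) / δ)
      rw [← heq] at h4
      linarith
    intro z hz z' hz' heq
    rcases lt_trichotomy (z : ℝ) z' with hlt | he | hlt
    · exact absurd heq (key z hz z' hz' hlt)
    · exact Subtype.ext he
    · exact absurd heq.symm (key z' hz' z hz hlt)

/-- translation along an invariant set. -/
theorem trans_lemma {G T D} (S : Setup G T D) {X : Set I01} (hX : ∀ g ∈ G, ∀ z ∈ X, g z ∈ X)
    (c : ℝ) (h : ∀ z ∈ X, ∃ w : I01, (w : ℝ) = z + c ∧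
      ∀ d ∈ D, ¬ ((w : ℝ) < d ∧ d ≤ z) ∧ ¬ ((z : ℝ) < d ∧ d ≤ w)) :
    ∀ g ∈ G, ∀ z ∈ X, ∀ w : I01, (w : ℝ) = z + c → (g w : ℝ) = g z + c := by
  have hTG : ∀ g ∈ T, g ∈ G := fun g hg => S.cl ▸ Subgroup.subset_closure hg
  intro g hg
  rw [← S.cl] at hg
  induction hg using Subgroup.closure_induction with
  | mem s hs =>
    intro z hz w hw
    obtain ⟨w', hw', hd⟩ := h z hz
    obtain rfl : w = w' := Subtype.ext (hw.trans hw'.symm)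
    rcases le_total (z : ℝ) w with hle | hle
    · have := (S.tame s hs).1 z w hle fun d hdD => (hd d hdD).2
      linarith
    · have := (S.tame s hs).1 w z hle fun d hdD => (hd d hdD).1
      linarith
  | one => intro z hz w hw; simpa using hw
  | mul a b ha hb iha ihb =>
    intro z hz w hw
    rw [S.cl] at ha hb
    exact iha (b z) (hX b hb z hz) (b w) (ihb z hz w hw)
  | inv a ha iha =>
    intro z hz w hw
    rw [S.cl] at ha
    have hz' := hX _ (G.inv_mem ha) z hz
    obtain ⟨w', hw', -⟩ := h _ hz'
    have := iha _ hz' w' hw'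
    rw [show a (a⁻¹ z) = z from a.apply_symm_apply z] at this
    have : a w' = w := Subtype.ext (this.trans hw.symm)
    rw [← this, show a⁻¹ (a w') = w' from a.symm_apply_apply w']
    exact hw'

theorem l_lemma0 {G T D} (S : Setup G T D) (x : I01) {δ : ℝ} (hδ : 0 < δ)
    (h : ∀ z ∈ Orb G x, ∀ d ∈ D, ¬ (d ≤ z ∧ (z : ℝ) < d + δ)) : (Orb G x).Finite := by
  refine sep_finite hδ fun z hz z' hz' hlt => ?_
  by_contra hcon
  push Not at hcon
  have key : ∀ g ∈ G, ∀ y ∈ Orb G x, ∀ w : I01, (w : ℝ) = y + (z - z') → (g w : ℝ) = g y + (z - z') := by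
    refine trans_lemma S (fun g hg y hy => Orb.smul hg hy) _ fun y hy => ?_
    have h0 : δ ≤ y := by
      by_contra hc
      exact h y hy 0 S.zero ⟨y.2.1, by linarith⟩
    refine ⟨⟨y + (z - z'), by linarith, by linarith [y.2.2]⟩, rfl, fun d hd => ⟨fun hh => ?_, fun hh => ?_⟩⟩
    · dsimp only at hh
      exact h y hy d hd ⟨hh.2, by linarith⟩
    · dsimp only at hh
      linarith
  have step : ∀ y ∈ Orb G x, ∃ w ∈ Orb G x, (w : ℝ) = y + (z - z') := by
    intro y hy
    rw [← Orb.eq hz'] at hy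
    obtain ⟨g, hg, rfl⟩ := hy
    exact ⟨g z, Orb.smul hg hz, key g hg z' hz' z (by ring)⟩
  have iter : ∀ n : ℕ, ∃ w ∈ Orb G x, (w : ℝ) = z' + n * (z - z') := by
    intro n
    induction n with
    | zero => exact ⟨z', hz', by simp⟩
    | succ n ih =>
      obtain ⟨w, hw, e⟩ := ih
      obtain ⟨w', hw', e'⟩ := step w hw
      exact ⟨w', hw', by rw [e', e]; push_cast; ring⟩
  obtain ⟨n, hn⟩ := exists_nat_gt (1 / ((z' : ℝ) - z))
  obtain ⟨w, -, hw⟩ := iter n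
  have hp : (0 : ℝ) < z' - z := by linarith
  rw [div_lt_iff₀ hp] at hn
  have := w.2.1
  have := z'.2.2
  nlinarith

theorem l_lemma {G T D} (S : Setup G T D) (x : I01) (hx : x ∉ Fin' G) :
    ∃ d ∈ D, ∀ δ > 0, ∃ z ∈ Orb G x, d ≤ z ∧ (z : ℝ) < d + δ := by
  by_contra hcon
  push Not at hcon
  have h1 : ∀ᶠ δ in 𝓝[>] (0 : ℝ), ∀ d ∈ D, ∀ z ∈ Orb G x, d ≤ z → d + δ ≤ z := by
    rw [Filter.eventually_all_finset]
    intro d hd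
    obtain ⟨δ, hδ, h⟩ := hcon d hd
    filter_upwards [Ioo_mem_nhdsGT hδ] with t ht z hz hdz
    have := h z hz hdz
    linarith [ht.2]
  obtain ⟨δ, h, hδ⟩ := (h1.and self_mem_nhdsWithin).exists
  refine hx (l_lemma0 S x (δ := δ) hδ fun z hz d hd hh => ?_)
  have := h d hd z hz hh.1
  linarith [hh.2]

theorem FUP.rightOpen {J : Set I01} (h : FUP J) {x : I01} :
    ∃ ε > 0, ∀ y : I01, (x : ℝ) ≤ y → (y : ℝ) < x + ε → (x ∈ J ↔ y ∈ J) := by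
  obtain ⟨P, hP⟩ := h
  have h1 : ∀ᶠ ε in 𝓝[>] (0 : ℝ), ∀ p ∈ P, (x : ℝ) < p → x + ε ≤ p := by
    rw [Filter.eventually_all_finset]
    intro p hp
    by_cases hxp : (x : ℝ) < p
    · filter_upwards [Ioo_mem_nhdsGT (sub_pos.2 hxp)] with t ht _
      linarith [ht.2]
    · exact Filter.Eventually.of_forall fun t h => absurd h hxp
  obtain ⟨ε, h, hε⟩ := (h1.and self_mem_nhdsWithin).exists
  refine ⟨ε, hε, fun y hxy hy => hP x y hxy fun p hp hh => ?_⟩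
  have := h p hp hh.1
  linarith [hh.2]

theorem FUP.compl {J : Set I01} (h : FUP J) : FUP Jᶜ := by
  obtain ⟨P, hP⟩ := h
  exact ⟨P, fun x y hxy hd => not_congr (hP x y hxy hd)⟩

theorem FUP.union {J K : Set I01} (h : FUP J) (h' : FUP K) : FUP (J ∪ K) := by
  classical
  obtain ⟨P, hP⟩ := h
  obtain ⟨Q, hQ⟩ := h'
  refine ⟨P ∪ Q, fun x y hxy hd => or_congr (hP x y hxy fun d hdP => hd d (by simp [hdP]))
    (hQ x y hxy fun d hdP => hd d (by simp [hdP]))⟩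

theorem FUP.isSubdomain {J : Set I01} (h : FUP J) (hne : J.Nonempty) : IsSubdomain J := by
  classical
  obtain ⟨P, hP⟩ := h
  refine ⟨hne, ((insert 0 (insert 1 P)) ×ˢ (insert 0 (insert 1 P))).filter fun p =>
    (0 ≤ p.1 ∧ p.1 < p.2 ∧ p.2 ≤ 1) ∧ ∀ x : I01, (x : ℝ) ∈ Ico p.1 p.2 → x ∈ J, ?_, ?_⟩
  · intro p hp
    exact (Finset.mem_filter.1 hp).2.1
  · intro x
    constructor
    · intro hx
      set Q := insert 0 (insert 1 P) with hQ
      have hA : (Q.filter fun p : ℝ => p ≤ x).Nonempty := ⟨0, by simp [hQ, x.2.1]⟩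
      have hB : (Q.filter fun p : ℝ => (x : ℝ) < p).Nonempty := ⟨1, by simp [hQ, x.2.2]⟩
      obtain ⟨p, hp, hpm⟩ := Finset.exists_max_image _ id hA
      obtain ⟨q, hq, hqm⟩ := Finset.exists_min_image _ id hB
      simp only [Finset.mem_filter, id] at hp hq hpm hqm
      refine ⟨(p, q), ?_, hp.2, hq.2⟩
      rw [Finset.mem_filter]
      refine ⟨Finset.mem_product.2 ⟨hp.1, hq.1⟩, ⟨?_, hp.2.trans_lt hq.2, ?_⟩, ?_⟩
      · exact hpm 0 ⟨by simp [hQ], x.2.1⟩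
      · exact hqm 1 ⟨by simp [hQ], x.2.2⟩
      · rintro y ⟨hy1, hy2⟩
        dsimp only at hy1 hy2
        rcases le_total (x : ℝ) y with hle | hle
        · refine (hP x y hle fun d hd hh => ?_).1 hx
          have := hqm d ⟨by simp [hQ, hd], hh.1⟩
          linarith [hh.2]
        · refine (hP y x hle fun d hd hh => ?_).2 hx
          have := hpm d ⟨by simp [hQ, hd], hh.2⟩
          linarith [hh.1]
    · rintro ⟨p, hp, hx⟩
      exact (Finset.mem_filter.1 hp).2.2 x hx

theorem FUP.of_Ico (a b : ℝ) : FUP {x : I01 | a ≤ x ∧ (x : ℝ) < b} := by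
  classical
  refine ⟨{a, b}, fun x y hxy hd => ?_⟩
  have h1 := hd a (by simp)
  have h2 := hd b (by simp)
  simp only [mem_ofPred_eq]
  constructor
  · rintro ⟨h3, h4⟩
    exact ⟨h3.trans hxy, by by_contra hc; exact h2 ⟨h4, not_lt.1 hc⟩⟩
  · rintro ⟨h3, h4⟩
    exact ⟨by by_contra hc; exact h1 ⟨not_le.1 hc, h3⟩, hxy.trans_lt h4⟩

theorem FUP.empty : FUP ∅ := ⟨∅, by simp⟩

theorem FUP.biUnion {ι : Type*} (s : Finset ι) (f : ι → Set I01) (h : ∀ i ∈ s, FUP (f i)) :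
    FUP (⋃ i ∈ s, f i) := by
  classical
  induction s using Finset.induction_on with
  | empty => simpa using FUP.empty
  | insert a s ha ih =>
    rw [Finset.set_biUnion_insert]
    exact (h a (by simp)).union (ih fun i hi => h i (by simp [hi]))

theorem IsSubdomain.fup {J : Set I01} (h : IsSubdomain J) : FUP J := by
  obtain ⟨-, F, -, hF⟩ := h
  have : J = ⋃ p ∈ F, {x : I01 | p.1 ≤ x ∧ (x : ℝ) < p.2} := by
    ext x
    rw [hF]
    simp only [mem_iUnion, exists_prop]
    rfl
  rw [this]
  exact FUP.biUnion _ _ fun p _ => FUP.of_Ico _ _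

def Good (G : Subgroup (Equiv.Perm I01)) (D : Finset ℝ) (w x : I01) : Prop :=
  (w : ℝ) ≤ x ∧ ∀ z ∈ Orb G w, ∀ d ∈ D, ¬ ((z : ℝ) < d ∧ d ≤ z + (x - w))

theorem Good.shift {G T D} (S : Setup G T D) {w x : I01} (h : Good G D w x) :
    ∀ g ∈ G, (g x : ℝ) = g w + (x - w) := by
  intro g hg
  refine trans_lemma S (X := Orb G w) (fun g hg y hy => Orb.smul hg hy) (x - w) ?_ g hg w
    (Orb.self G w) x (by ring)
  intro z hz
  have h1 : (z : ℝ) + (x - w) < 1 := by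
    by_contra hc
    exact h.2 z hz 1 S.one ⟨z.2.2, not_lt.1 hc⟩
  have h2 := h.1
  refine ⟨⟨z + (x - w), by linarith [z.2.1], h1⟩, rfl, fun d hd => ⟨fun hh => ?_, fun hh => ?_⟩⟩
  · dsimp only at hh
    linarith
  · exact h.2 z hz d hd hh

theorem orb_finite_of_shift {G : Subgroup (Equiv.Perm I01)} {w x : I01} {c : ℝ}
    (h : ∀ g ∈ G, (g x : ℝ) = g w + c) (hw : w ∈ Fin' G) : x ∈ Fin' G := by
  have h1 : ((fun z : I01 => (z : ℝ) + c) '' Orb G w).Finite := Set.Finite.image _ hw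
  refine (h1.preimage (f := fun z : I01 => (z : ℝ)) Subtype.val_injective.injOn).subset ?_
  rintro y ⟨g, hg, rfl⟩
  exact ⟨g w, ⟨g, hg, rfl⟩, (h g hg).symm⟩

def EE (G : Subgroup (Equiv.Perm I01)) (D : Finset ℝ) : Set I01 :=
  {w | w ∈ Fin' G ∧ ∃ d : I01, (d : ℝ) ∈ D ∧ w ∈ Orb G d}

theorem dpts_finite (D : Finset ℝ) : {d : I01 | (d : ℝ) ∈ D}.Finite :=
  (D.finite_toSet).preimage (f := fun z : I01 => (z : ℝ)) Subtype.val_injective.injOn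

theorem EE_finite (G : Subgroup (Equiv.Perm I01)) (D : Finset ℝ) : (EE G D).Finite := by
  have h : (⋃ d ∈ {d : I01 | (d : ℝ) ∈ D} ∩ Fin' G, Orb G d).Finite :=
    ((dpts_finite D).inter_of_left _).biUnion fun d hd => hd.2
  refine h.subset ?_
  rintro w ⟨hw, d, hd, hwd⟩
  simp only [mem_iUnion]
  refine ⟨d, ⟨hd, ?_⟩, hwd⟩
  have := Orb.eq hwd
  unfold Fin' at hw ⊢
  rw [mem_ofPred_eq] at hw ⊢
  rwa [← this]

theorem exists_good {G T D} (S : Setup G T D) {x : I01} (hx : x ∈ Fin' G) :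
    ∃ w ∈ EE G D, Good G D w x := by
  have hfin : {p : I01 × ℝ | p.1 ∈ Orb G x ∧ p.2 ∈ D ∧ p.2 ≤ p.1}.Finite := by
    refine (Set.Finite.prod (show (Orb G x).Finite from hx) D.finite_toSet).subset ?_
    rintro ⟨a, b⟩ h
    exact ⟨h.1, h.2.1⟩
  obtain ⟨⟨z0, d0⟩, ⟨hz0, hd0, hle⟩, hmin⟩ := Set.exists_min_image _
    (fun p : I01 × ℝ => (p.1 : ℝ) - p.2) hfin ⟨(x, 0), Orb.self G x, S.zero, x.2.1⟩
  dsimp only at hz0 hd0 hle hmin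
  have hmin' : ∀ z ∈ Orb G x, ∀ d ∈ D, d ≤ z → (z0 : ℝ) - d0 ≤ z - d :=
    fun z hz d hd h => hmin (z, d) ⟨hz, hd, h⟩
  clear hmin
  set t := (z0 : ℝ) - d0 with ht
  have ht0 : 0 ≤ t := by linarith
  have hge : ∀ z ∈ Orb G x, t ≤ z := fun z hz => by
    have := hmin' z hz 0 S.zero z.2.1
    linarith
  have key := trans_lemma S (X := Orb G x) (fun g hg y hy => Orb.smul hg hy) (-t) (by
    intro z hz
    refine ⟨⟨z + -t, by linarith [hge z hz], by linarith [z.2.2]⟩, rfl, fun d hd => ⟨fun hh => ?_, fun hh => ?_⟩⟩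
    · dsimp only at hh
      have := hmin' z hz d hd hh.2
      linarith
    · dsimp only at hh
      linarith)
  have hxt := hge x (Orb.self G x)
  let w : I01 := ⟨x + -t, by linarith, by linarith [x.2.2]⟩
  have hw : (w : ℝ) = x + -t := rfl
  have hgw : ∀ g ∈ G, (g w : ℝ) = g x + -t := fun g hg => key g hg x (Orb.self G x) w hw
  obtain ⟨g0, hg0, hgz0⟩ := hz0
  refine ⟨w, ⟨orb_finite_of_shift hgw hx, g0 w, ?_, g0⁻¹, G.inv_mem hg0, g0.symm_apply_apply w⟩, ?_, ?_⟩
  · rw [hgw g0 hg0, hgz0, ht]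
    simpa using hd0
  · linarith
  · rintro z ⟨g, hg, rfl⟩ d hd ⟨h1, h2⟩
    rw [hgw g hg] at h1 h2
    have := hmin' (g x) ⟨g, hg, rfl⟩ d hd (by linarith)
    linarith

theorem mem_fin_iff {G T D} (S : Setup G T D) (x : I01) :
    x ∈ Fin' G ↔ ∃ w ∈ EE G D, Good G D w x := by
  refine ⟨exists_good S, ?_⟩
  rintro ⟨w, hw, h⟩
  exact orb_finite_of_shift (h.shift S) hw.1

theorem fin_FUP {G T D} (S : Setup G T D) : FUP (Fin' G) := by
  classical
  let E := (EE_finite G D).toFinset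
  have hE : ∀ w, w ∈ E ↔ w ∈ EE G D := fun w => Set.Finite.mem_toFinset _
  refine ⟨(E.image fun w : I01 => (w : ℝ)) ∪
    ((E ×ˢ E) ×ˢ D).image fun p => (p.1.1 : ℝ) + (p.2 - p.1.2), fun x y hxy hd => ?_⟩
  rw [mem_fin_iff S, mem_fin_iff S]
  refine exists_congr fun w => and_congr_right fun hw => ?_
  have h1 := hd w (by
    rw [Finset.mem_union]; left
    exact Finset.mem_image_of_mem _ ((hE w).2 hw))
  have h2 : ∀ z ∈ Orb G w, ∀ d ∈ D, ¬ ((x : ℝ) < w + (d - z) ∧ w + (d - z) ≤ y) := by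
    intro z hz d hdD
    refine hd _ ?_
    rw [Finset.mem_union]; right
    refine Finset.mem_image.2 ⟨((w, z), d), ?_, rfl⟩
    simp only [Finset.mem_product]
    refine ⟨⟨(hE w).2 hw, (hE z).2 ?_⟩, hdD⟩
    obtain ⟨hwf, d', hd', hwd⟩ := hw
    obtain ⟨g, hg, rfl⟩ := hz
    exact ⟨(Fin'.inv hg).2 hwf, d', hd', Orb.smul hg hwd⟩
  unfold Good
  constructor
  · rintro ⟨ha, hb⟩
    refine ⟨ha.trans hxy, fun z hz d hd hh => hb z hz d hd ⟨hh.1, ?_⟩⟩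
    by_contra hc
    exact h2 z hz d hd ⟨by linarith, by linarith [hh.2]⟩
  · rintro ⟨ha, hb⟩
    refine ⟨?_, fun z hz d hd hh => hb z hz d hd ⟨hh.1, by linarith [hh.2]⟩⟩
    by_contra hc
    exact h1 ⟨not_le.1 hc, ha⟩

theorem restrict_finite {G T D} (S : Setup G T D) (K : Set I01) (hK : K = Fin' G) :
    Set.Finite {f : K → I01 | ∃ g ∈ G, f = Set.restrict K ⇑g} := by
  subst hK
  have hfin := EE_finite G D
  have : Finite (EE G D) := hfin
  refine Set.Finite.of_injOn (f := fun (f : Fin' G → I01) (w : EE G D) => f ⟨w.1, w.2.1⟩)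
    (t := {φ | ∀ w, φ w ∈ EE G D}) ?_ ?_ (Set.Finite.pi' fun _ => hfin)
  · rintro f ⟨g, hg, rfl⟩ w
    obtain ⟨hwf, d', hd', hwd⟩ := w.2
    exact ⟨(Fin'.inv hg).2 hwf, d', hd', Orb.smul hg hwd⟩
  · rintro f ⟨g, hg, rfl⟩ f' ⟨g', hg', rfl⟩ heq
    funext x
    obtain ⟨w, hw, hgood⟩ := exists_good S x.2
    have h1 := hgood.shift S g hg
    have h2 := hgood.shift S g' hg'
    have h3 : g w = g' w := congrFun heq ⟨w, hw⟩
    apply Subtype.ext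
    change (g x : ℝ) = g' x
    rw [h1, h2, h3]

structure MGood (A : Set I01) (D : Finset ℝ) (m : ℝ) : Prop where
  pos : 0 < m
  sep : ∀ d ∈ D, ∀ d' ∈ D, d < d' → d + m ≤ d'
  right : ∀ d ∈ D, (∃ ε > 0, ∀ a ∈ A, ¬ (d < a ∧ (a : ℝ) < d + ε)) →
    ∀ a ∈ A, ¬ (d < a ∧ (a : ℝ) < d + m)
  left : ∀ d ∈ D, (∃ ε > 0, ∀ a ∈ A, ¬ (d - ε < a ∧ (a : ℝ) < d)) →
    ∀ a ∈ A, ¬ (d - m < a ∧ (a : ℝ) < d)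

theorem exists_mgood (A : Set I01) (D : Finset ℝ) : ∃ m, MGood A D m := by
  have h1 : ∀ᶠ m in 𝓝[>] (0 : ℝ), ∀ d ∈ D, ∀ d' ∈ D, d < d' → d + m ≤ d' := by
    rw [Filter.eventually_all_finset]
    intro d hd
    rw [Filter.eventually_all_finset]
    intro d' hd'
    by_cases h : d < d'
    · filter_upwards [Ioo_mem_nhdsGT (sub_pos.2 h)] with t ht _
      linarith [ht.2]
    · exact Filter.Eventually.of_forall fun t h' => absurd h' h
  have h2 : ∀ᶠ m in 𝓝[>] (0 : ℝ), ∀ d ∈ D, (∃ ε > 0, ∀ a ∈ A, ¬ (d < a ∧ (a : ℝ) < d + ε)) →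
    ∀ a ∈ A, ¬ (d < a ∧ (a : ℝ) < d + m) := by
    rw [Filter.eventually_all_finset]
    intro d hd
    by_cases h : (∃ ε > 0, ∀ a ∈ A, ¬ (d < a ∧ (a : ℝ) < d + ε))
    · obtain ⟨ε, hε, h⟩ := h
      filter_upwards [Ioo_mem_nhdsGT hε] with t ht _ a ha hh
      exact h a ha ⟨hh.1, by linarith [hh.2, ht.2]⟩
    · exact Filter.Eventually.of_forall fun t h' => absurd h' h
  have h3 : ∀ᶠ m in 𝓝[>] (0 : ℝ), ∀ d ∈ D, (∃ ε > 0, ∀ a ∈ A, ¬ (d - ε < a ∧ (a : ℝ) < d)) →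
    ∀ a ∈ A, ¬ (d - m < a ∧ (a : ℝ) < d) := by
    rw [Filter.eventually_all_finset]
    intro d hd
    by_cases h : (∃ ε > 0, ∀ a ∈ A, ¬ (d - ε < a ∧ (a : ℝ) < d))
    · obtain ⟨ε, hε, h⟩ := h
      filter_upwards [Ioo_mem_nhdsGT hε] with t ht _ a ha hh
      exact h a ha ⟨by linarith [hh.1, ht.2], hh.2⟩
    · exact Filter.Eventually.of_forall fun t h' => absurd h' h
  obtain ⟨m, ⟨⟨a, b⟩, c⟩, d⟩ := (((h1.and h2).and h3).and self_mem_nhdsWithin).exists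
  exact ⟨m, d, a, b, c⟩

/-- gap containing no breakpoint in its interior -/
def GapD (A : Set I01) (D : Finset ℝ) (t : ℝ) : Set I01 :=
  {x | ∃ u : ℝ, 0 ≤ u ∧ u + t ≤ 1 ∧ u ≤ x ∧ (x : ℝ) < u + t ∧
    (∀ a ∈ A, ¬ (u < a ∧ (a : ℝ) < u + t)) ∧ ∀ d ∈ D, ¬ (u < d ∧ d < u + t)}

theorem GapD.gap {A D t} {x : I01} (h : x ∈ GapD A D t) : x ∈ Gap A t := by
  obtain ⟨u, h1, h2, h3, h4, h5, -⟩ := h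
  exact ⟨u, h1, h2, h3, h4, h5⟩

theorem gap_cut {G T D} (S : Setup G T D) {A : Set I01} {m t t' : ℝ} (hm : MGood A D m)
    (htt : t ≤ t') (htm : t' ≤ m) {x : I01} {u d : ℝ} (h0 : 0 ≤ u) (h1 : u + t ≤ 1)
    (hux : u ≤ x) (hxu : (x : ℝ) < u + t)
    (hA : ∀ a ∈ A, ¬ (u < a ∧ (a : ℝ) < u + t)) (hd : d ∈ D) (hud : u < d) (hdu : d < u + t) :
    x ∈ GapD A D t' := by
  have hd0 : 0 + m ≤ d := hm.sep 0 S.zero d hd (by linarith)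
  have hd1 : d + m ≤ 1 := hm.sep d hd 1 S.one (by linarith)
  have hR := hm.right d hd ⟨u + t - d, by linarith, fun a ha hh => hA a ha
    ⟨by linarith [hh.1], by linarith [hh.2]⟩⟩
  have hL := hm.left d hd ⟨d - u, by linarith, fun a ha hh => hA a ha
    ⟨by linarith [hh.1], by linarith [hh.2]⟩⟩
  rcases le_or_gt d x with hdx | hdx
  · refine ⟨d, by linarith [hm.pos], by linarith, hdx, by linarith, fun a ha hh => hR a ha
      ⟨hh.1, by linarith [hh.2]⟩, fun d' hd' hh => ?_⟩
    have := hm.sep d hd d' hd' hh.1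
    linarith [hh.2]
  · refine ⟨d - t', by linarith, by linarith [hm.pos], by linarith, by linarith,
      fun a ha hh => hL a ha ⟨by linarith [hh.1], by linarith [hh.2]⟩, fun d' hd' hh => ?_⟩
    have := hm.sep d' hd' d hd (by linarith [hh.2])
    linarith [hh.1]

theorem gap_gapD {G T D} (S : Setup G T D) {A : Set I01} {m t : ℝ} (hm : MGood A D m)
    (htm : t ≤ m) {x : I01} (hx : x ∈ Gap A t) : x ∈ GapD A D t := by
  obtain ⟨u, h0, h1, h2, h3, h4⟩ := hx
  by_cases h : ∀ d ∈ D, ¬ (u < d ∧ d < u + t)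
  · exact ⟨u, h0, h1, h2, h3, h4, h⟩
  · push Not at h
    obtain ⟨d, hd, hud, hdu⟩ := h
    exact gap_cut S hm le_rfl htm h0 h1 h2 h3 h4 hd hud hdu

theorem gapD_step {A : Set I01} {D : Finset ℝ} {t : ℝ} {s : Equiv.Perm I01} (hs : Tame D s)
    (hA : ∀ a, s a ∈ A → a ∈ A) {x : I01} (hx : x ∈ GapD A D t) : s x ∈ Gap A t := by
  obtain ⟨u, h0, h1, h2, h3, h4, h5⟩ := hx
  have key : ∀ y : I01, u ≤ y → (y : ℝ) < u + t → (s y : ℝ) = y + (s x - x) := by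
    intro y hy1 hy2
    rcases le_total (x : ℝ) y with hle | hle
    · have := hs x y hle fun d hd hh => h5 d hd ⟨by linarith [hh.1], by linarith [hh.2]⟩
      linarith
    · have := hs y x hle fun d hd hh => h5 d hd ⟨by linarith [hh.1], by linarith [hh.2]⟩
      linarith
  set c := (s x : ℝ) - x with hc
  have hu := key ⟨u, h0, by linarith [x.2.2]⟩ le_rfl (by dsimp only; linarith)
  dsimp only at hu
  refine ⟨u + c, ?_, ?_, by linarith, by linarith, ?_⟩
  · rw [← hu]; exact (s _).2.1
  · by_contra hcon
    push Not at hcon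
    have hlt : max u (1 - c) < u + t := max_lt (by linarith) (by linarith)
    have := key ⟨max u (1 - c), h0.trans (le_max_left _ _), by linarith⟩ (le_max_left _ _) hlt
    dsimp only at this
    have h6 := (s ⟨max u (1 - c), h0.trans (le_max_left _ _), by linarith⟩).2.2
    rw [this] at h6
    linarith [le_max_right u (1 - c)]
  · intro a ha hh
    have h6 : (a : ℝ) - c < 1 := by linarith [hh.2]
    have h7 := key ⟨a - c, by linarith [hh.1], h6⟩ (by dsimp only; linarith [hh.1])
      (by dsimp only; linarith [hh.2])
    dsimp only at h7
    have h8 : s ⟨a - c, by linarith [hh.1], h6⟩ = a := Subtype.ext (by rw [h7]; ring)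
    have h9 := hA ⟨a - c, by linarith [hh.1], h6⟩ (by rw [h8]; exact ha)
    exact h4 _ h9 ⟨by dsimp only; linarith [hh.1], by dsimp only; linarith [hh.2]⟩

theorem gap_inv {G T D} (S : Setup G T D) {A : Set I01} (hA : ∀ g ∈ G, ∀ a ∈ A, g a ∈ A)
    {m t : ℝ} (hm : MGood A D m) (htm : t ≤ m) :
    ∀ g ∈ G, ∀ x ∈ Gap A t, g x ∈ Gap A t := by
  have hTG : ∀ g ∈ T, g ∈ G := fun g hg => S.cl ▸ Subgroup.subset_closure hg
  have hA' : ∀ g ∈ G, ∀ a, g a ∈ A → a ∈ A := by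
    intro g hg a ha
    have := hA g⁻¹ (G.inv_mem hg) _ ha
    rwa [show g⁻¹ (g a) = a from g.symm_apply_apply a] at this
  have : ∀ g ∈ G, (∀ x ∈ Gap A t, g x ∈ Gap A t) ∧ ∀ x ∈ Gap A t, g⁻¹ x ∈ Gap A t := by
    intro g hg
    rw [← S.cl] at hg
    induction hg using Subgroup.closure_induction with
    | mem s hs =>
      exact ⟨fun x hx => gapD_step (S.tame s hs).1 (hA' s (hTG s hs)) (gap_gapD S hm htm hx),
        fun x hx => gapD_step (S.tame s hs).2 (hA' _ (G.inv_mem (hTG s hs))) (gap_gapD S hm htm hx)⟩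
    | one => exact ⟨fun x hx => hx, fun x hx => by simpa using hx⟩
    | mul a b ha hb iha ihb =>
      refine ⟨fun x hx => iha.1 _ (ihb.1 x hx), fun x hx => ?_⟩
      rw [mul_inv_rev]
      exact ihb.2 _ (iha.2 x hx)
    | inv a ha iha => exact ⟨iha.2, by rw [inv_inv]; exact iha.1⟩
  exact fun g hg => (this g hg).1

theorem gap_mono {A : Set I01} {t t' : ℝ} (ht' : 0 < t') (h : t' ≤ t) {x : I01} (hx : x ∈ Gap A t) :
    x ∈ Gap A t' := by
  obtain ⟨u, h0, h1, h2, h3, h4⟩ := hx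
  rcases lt_or_ge (x : ℝ) (u + t') with h5 | h5
  · exact ⟨u, h0, by linarith, h2, h5, fun a ha hh => h4 a ha ⟨hh.1, by linarith [hh.2]⟩⟩
  · rcases lt_or_ge (x : ℝ) (u + t - t') with h6 | h6
    · exact ⟨x, by linarith, by linarith, le_rfl, by linarith,
        fun a ha hh => h4 a ha ⟨by linarith [hh.1], by linarith [hh.2]⟩⟩
    · exact ⟨u + t - t', by linarith, by linarith, h6, by linarith,
        fun a ha hh => h4 a ha ⟨by linarith [hh.1], by linarith [hh.2]⟩⟩

theorem gap_up {G T D} (S : Setup G T D) {A : Set I01} (hA : ∀ g ∈ G, ∀ a ∈ A, g a ∈ A)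
    {m t : ℝ} (hm : MGood A D m) (ht : 0 < t) {x : I01} (hx : x ∉ Fin' G)
    (hxt : x ∈ Gap A t) : x ∈ Gap A m := by
  wlog htm : t ≤ m generalizing t
  · exact gap_mono hm.pos (not_le.1 htm).le hxt
  obtain ⟨d, hd, hacc⟩ := l_lemma S x hx
  have horb : ∀ z ∈ Orb G x, z ∈ Gap A t := by
    rintro z ⟨g, hg, rfl⟩
    exact gap_inv S hA hm htm g hg x hxt
  have back : ∀ z ∈ Orb G x, z ∈ Gap A m → x ∈ Gap A m := by
    rintro z ⟨g, hg, rfl⟩ hz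
    have := gap_inv S hA hm le_rfl g⁻¹ (G.inv_mem hg) _ hz
    rwa [show g⁻¹ (g x) = x from g.symm_apply_apply x] at this
  by_cases hcut : ∃ z ∈ Orb G x, ∃ u : ℝ, 0 ≤ u ∧ u + t ≤ 1 ∧ u ≤ z ∧ (z : ℝ) < u + t ∧
      (∀ a ∈ A, ¬ (u < a ∧ (a : ℝ) < u + t)) ∧ u < d ∧ d < u + t
  · obtain ⟨z, hz, u, h0, h1, h2, h3, h4, h5, h6⟩ := hcut
    exact back z hz (GapD.gap (gap_cut S hm htm le_rfl h0 h1 h2 h3 h4 hd h5 h6))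
  · push Not at hcut
    have hwit : ∀ δ > 0, δ ≤ t → ∃ z ∈ Orb G x, ∃ u : ℝ, d ≤ u ∧ u ≤ z ∧ (z : ℝ) < d + δ ∧
        u + t ≤ 1 ∧ ∀ a ∈ A, ¬ (u < a ∧ (a : ℝ) < u + t) := by
      intro δ hδ hδt
      obtain ⟨z, hz, h1, h2⟩ := hacc δ hδ
      obtain ⟨u, k0, k1, k2, k3, k4⟩ := horb z hz
      refine ⟨z, hz, u, ?_, k2, h2, k1, k4⟩
      by_contra hc
      have := hcut z hz u k0 k1 k2 k3 (fun a ha hh => by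
        by_contra hlt
        exact k4 a ha ⟨hh, not_le.1 hlt⟩) (not_le.1 hc)
      linarith
    have hR := hm.right d hd ⟨t, ht, fun a ha hh => by
      obtain ⟨z, hz, u, h1, h2, h3, -, h4⟩ := hwit (min t (a - d))
        (lt_min ht (by linarith [hh.1])) (min_le_left _ _)
      have := min_le_right t (a - d)
      exact h4 a ha ⟨by linarith, by linarith [hh.2]⟩⟩
    obtain ⟨z, hz, u, h1, h2, h3, h5, -⟩ := hwit t ht le_rfl
    refine back z hz ⟨d, (S.sub d hd).1, hm.sep d hd 1 S.one (by linarith), by linarith,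
      by linarith, hR⟩

theorem gap_disj {G T D} (S : Setup G T D) {A : Set I01} (hA : ∀ g ∈ G, ∀ a ∈ A, g a ∈ A)
    {m : ℝ} (hm : MGood A D m) (hU : ∀ a ∈ A, a ∉ Fin' G) {a : I01} (ha : a ∈ A) :
    a ∉ Gap A m := by
  intro hg
  have hfin : (A ∩ Gap A m).Finite := by
    refine sep_finite hm.pos ?_
    rintro z ⟨hz, u, -, -, h1, h2, h3⟩ z' ⟨hz', -⟩ hlt
    by_contra hc
    by_cases hu : u < z
    · exact h3 z hz ⟨hu, h2⟩
    · exact h3 z' hz' ⟨by linarith, by linarith⟩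
  refine hU a ha (hfin.subset ?_)
  rintro y ⟨g, hgG, rfl⟩
  exact ⟨hA g hgG a ha, gap_inv S hA hm le_rfl g hgG a hg⟩

theorem gap_FUP (A : Set I01) {m : ℝ} (hm : 0 < m) : FUP (Gap A m) := by
  classical
  let K : Set ℝ := {u | 0 ≤ u ∧ u ≤ 1 - m ∧ ∀ a ∈ A, ¬ (u < a ∧ (a : ℝ) < u + m)}
  have hKc : IsClosed K := by
    have : K = Icc 0 (1 - m) ∩ ⋂ a ∈ A, ({u : ℝ | (a : ℝ) ≤ u} ∪ {u : ℝ | u + m ≤ a}) := by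
      ext u
      simp only [K, mem_ofPred_eq, mem_inter_iff, mem_iInter, mem_union, mem_Icc, not_and_or, not_lt,
        and_assoc]
    rw [this]
    refine isClosed_Icc.inter (isClosed_biInter fun a _ => IsClosed.union ?_ ?_)
    · exact isClosed_Ici
    · exact isClosed_le (by fun_prop) (by fun_prop)
  let N := ⌊1 / m⌋₊ + 1
  let f : ℕ → Set I01 := fun k => {x | ∃ u ∈ K ∩ Icc (k * m) ((k + 1) * m), u ≤ x ∧ (x : ℝ) < u + m}
  have hun : Gap A m = ⋃ k ∈ Finset.range N, f k := by
    ext x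
    simp only [mem_iUnion, exists_prop, Finset.mem_range]
    constructor
    · rintro ⟨u, h0, h1, h2, h3, h4⟩
      refine ⟨⌊u / m⌋₊, ?_, u, ⟨⟨h0, by linarith, h4⟩, ?_, ?_⟩, h2, h3⟩
      · refine Nat.lt_succ_of_le (Nat.floor_le_floor ?_)
        gcongr
        linarith
      · rw [← le_div_iff₀ hm]; exact Nat.floor_le (div_nonneg h0 hm.le)
      · rw [← div_le_iff₀ hm]; exact (Nat.lt_floor_add_one _).le
    · rintro ⟨k, -, u, ⟨⟨h0, h1, h4⟩, -⟩, h2, h3⟩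
      exact ⟨u, h0, by linarith, h2, h3, h4⟩
  rw [hun]
  refine FUP.biUnion _ _ fun k _ => ?_
  have hcomp : IsCompact (K ∩ Icc (k * m) ((k + 1) * m)) := isCompact_Icc.inter_left hKc
  rcases (K ∩ Icc (k * m) ((k + 1) * m)).eq_empty_or_nonempty with he | hne
  · have : f k = ∅ := by
      refine Set.eq_empty_of_forall_notMem ?_
      rintro x ⟨u, hu, -⟩
      rw [he] at hu
      exact hu
    rw [this]; exact FUP.empty
  · obtain ⟨u0, hu0, hmin⟩ := hcomp.exists_isLeast hne
    obtain ⟨v0, hv0, hmax⟩ := hcomp.exists_isGreatest hne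
    have : f k = {x : I01 | u0 ≤ x ∧ (x : ℝ) < v0 + m} := by
      ext x
      constructor
      · rintro ⟨u, hu, h1, h2⟩
        exact ⟨(hmin hu).trans h1, by linarith [hmax hu]⟩
      · rintro ⟨h1, h2⟩
        rcases lt_or_ge (x : ℝ) (u0 + m) with h | h
        · exact ⟨u0, hu0, h1, h⟩
        · refine ⟨v0, hv0, ?_, h2⟩
          have := hu0.2.1
          have := hv0.2.2
          linarith
    rw [this]; exact FUP.of_Ico _ _

theorem rcl_struct {G T D} (S : Setup G T D) {x : I01} (hx : x ∉ Fin' G) :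
    FUP (rcl G x) ∧ (∀ g ∈ G, ∀ y ∈ rcl G x, g y ∈ rcl G x) ∧ ∀ y ∈ rcl G x, y ∉ Fin' G := by
  have hA : ∀ g ∈ G, ∀ a ∈ Orb G x, g a ∈ Orb G x := fun g hg a ha => Orb.smul hg ha
  have hU : ∀ a ∈ Orb G x, a ∉ Fin' G := by
    rintro a ⟨g, hg, rfl⟩
    rwa [Fin'.inv hg]
  obtain ⟨m, hm⟩ := exists_mgood (Orb G x) D
  have hsub : ∀ y ∈ rcl G x, y ∉ Fin' G := by
    intro y hy hyF
    obtain ⟨ε, hε, h⟩ := (fin_FUP S).rightOpen (x := y)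
    obtain ⟨z, hz, h1, h2⟩ := hy ε hε
    exact hU z hz ((h z h1 h2).1 hyF)
  have heq : rcl G x = (Fin' G ∪ Gap (Orb G x) m)ᶜ := by
    ext y
    rw [mem_compl_iff, mem_union, not_or]
    constructor
    · intro hy
      refine ⟨hsub y hy, ?_⟩
      rintro ⟨u, h0, h1, h2, h3, h4⟩
      obtain ⟨z, hz, k1, k2⟩ := hy (u + m - y) (by linarith)
      exact gap_disj S hA hm hU hz ⟨u, h0, h1, by linarith, by linarith, h4⟩
    · rintro ⟨hyF, hyG⟩ ε hε
      by_contra hcon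
      push Not at hcon
      refine hyG (gap_up S hA hm (t := min ε (1 - y)) (lt_min hε (by linarith [y.2.2])) hyF ?_)
      have e1 := min_le_left ε (1 - (y : ℝ))
      have e2 := min_le_right ε (1 - (y : ℝ))
      have e3 : 0 < min ε (1 - (y : ℝ)) := lt_min hε (by linarith [y.2.2])
      refine ⟨y, y.2.1, by linarith, le_rfl, by linarith, fun a ha hh => ?_⟩
      have := hcon a ha hh.1.le
      linarith [hh.2]
  refine ⟨?_, ?_, hsub⟩
  · rw [heq]
    exact ((fin_FUP S).union (gap_FUP _ hm.pos)).compl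
  · rw [heq]
    intro g hg y hy hgy
    refine hy (hgy.imp (fun h => (Fin'.inv hg).1 h) fun h => ?_)
    have := gap_inv S hA hm le_rfl g⁻¹ (G.inv_mem hg) _ h
    rwa [show g⁻¹ (g y) = y from g.symm_apply_apply y] at this

theorem rcl_self (G : Subgroup (Equiv.Perm I01)) (x : I01) : x ∈ rcl G x :=
  fun ε hε => ⟨x, Orb.self G x, le_rfl, by linarith⟩

theorem rcl_sub {G T D} (S : Setup G T D) {x y : I01} (hx : x ∉ Fin' G) (hy : y ∈ rcl G x) :
    rcl G y ⊆ rcl G x := by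
  intro z hz ε hε
  obtain ⟨w, ⟨g, hg, rfl⟩, h1, h2⟩ := hz ε hε
  obtain ⟨v, hv, h3, h4⟩ := (rcl_struct S hx).2.1 g hg y hy (z + ε - g y) (by linarith)
  exact ⟨v, hv, by linarith, by linarith⟩

theorem rcl_eq {G T D} (S : Setup G T D) {x y : I01} (hx : x ∉ Fin' G) (hy : y ∈ rcl G x) :
    rcl G y = rcl G x := by
  have hyF := (rcl_struct S hx).2.2 y hy
  refine (rcl_sub S hx hy).antisymm (rcl_sub S hyF ?_)
  obtain ⟨hF, hinv, -⟩ := rcl_struct S hyF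
  obtain ⟨ε, hε, h⟩ := hF.rightOpen (x := y)
  obtain ⟨z, ⟨g, hg, rfl⟩, h1, h2⟩ := hy ε hε
  have h3 := (h _ h1 h2).1 (rcl_self G y)
  have := hinv g⁻¹ (G.inv_mem hg) _ h3
  rwa [show g⁻¹ (g x) = x from g.symm_apply_apply x] at this

theorem rcl_closure (G : Subgroup (Equiv.Perm I01)) (x : I01) : rcl G x ⊆ closure (Orb G x) := by
  intro y hy
  rw [Metric.mem_closure_iff]
  intro ε hε
  obtain ⟨z, hz, h1, h2⟩ := hy ε hε
  refine ⟨z, hz, ?_⟩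
  rw [Subtype.dist_eq, Real.dist_eq, abs_lt]
  constructor <;> linarith

theorem inv_of_maps {G : Subgroup (Equiv.Perm I01)} {J : Set I01}
    (h : ∀ g ∈ G, ∀ y ∈ J, g y ∈ J) : ∀ g ∈ G, InvariantUnder g J := by
  intro g hg x
  refine ⟨fun hx => ?_, h g hg x⟩
  have := h g⁻¹ (G.inv_mem hg) _ hx
  rwa [show g⁻¹ (g x) = x from g.symm_apply_apply x] at this

theorem rcl_family_finite {G T D} (S : Setup G T D) : (rcl G '' (Fin' G)ᶜ).Finite := by
  refine ((dpts_finite D).image (rcl G)).subset ?_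
  rintro _ ⟨x, hx, rfl⟩
  obtain ⟨d, hd, hacc⟩ := l_lemma S x hx
  obtain ⟨z, -, hz, -⟩ := hacc 1 one_pos
  refine ⟨⟨d, (S.sub d hd).1, hz.trans_lt z.2.2⟩, hd, rcl_eq S hx ?_⟩
  exact hacc

theorem subset_of_closure {J K : Set I01} (hJ : FUP J) (hK : FUP K) (h : J ⊆ closure K) :
    J ⊆ K := by
  intro y hy
  by_contra hyK
  obtain ⟨ε, hε, h1⟩ := hJ.rightOpen (x := y)
  obtain ⟨δ, hδ, h2⟩ := hK.rightOpen (x := y)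
  have hη : 0 < min (min ε δ) (1 - y) := lt_min (lt_min hε hδ) (by linarith [y.2.2])
  set η := min (min ε δ) (1 - (y : ℝ)) with hηd
  have e1 : η ≤ ε := (min_le_left _ _).trans (min_le_left _ _)
  have e2 : η ≤ δ := (min_le_left _ _).trans (min_le_right _ _)
  have e3 : η ≤ 1 - y := min_le_right _ _
  have hy0 := y.2.1
  let p : I01 := ⟨y + η / 2, by linarith, by linarith⟩
  have hp : (p : ℝ) = y + η / 2 := rfl
  have hpJ : p ∈ J := (h1 p (by linarith) (by linarith)).1 hy
  have := h hpJ
  rw [Metric.mem_closure_iff] at this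
  obtain ⟨z, hz, hd⟩ := this (η / 2) (by linarith)
  rw [Subtype.dist_eq, Real.dist_eq, abs_lt] at hd
  exact hyK ((h2 z (by linarith) (by linarith)).2 hz)

theorem FUP.infinite {J : Set I01} (hJ : FUP J) (hne : J.Nonempty) : J.Infinite := by
  intro hfin
  obtain ⟨y, hy⟩ := hne
  obtain ⟨ε, hε, h1⟩ := hJ.rightOpen (x := y)
  have hη : 0 < min ε (1 - y) := lt_min hε (by linarith [y.2.2])
  set η := min ε (1 - (y : ℝ)) with hηd
  have e1 : η ≤ ε := min_le_left _ _
  have e3 : η ≤ 1 - y := min_le_right _ _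
  have hinf : (Ico (y : ℝ) (y + η)).Infinite := Ico_infinite (by linarith)
  refine hinf ((hfin.image (fun z : I01 => (z : ℝ))).subset ?_)
  rintro r ⟨hr1, hr2⟩
  refine ⟨⟨r, y.2.1.trans hr1, by linarith⟩, ?_, rfl⟩
  exact (h1 ⟨r, y.2.1.trans hr1, by linarith⟩ hr1 (by dsimp only; linarith)).1 hy

/-- any valid family covers exactly the non-finite orbits -/
theorem cover_eq {G : Subgroup (Equiv.Perm I01)} {S : Finset (Set I01)}
    (h1 : ∀ J ∈ S, IsSubdomain J)
    (h4 : ∀ J ∈ S, ∀ x ∈ J, J ⊆ closure {y : I01 | ∃ g ∈ G, g x = y})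
    (h6 : Set.Finite {f : ((⋃ J ∈ S, J)ᶜ : Set I01) → I01 |
        ∃ g ∈ G, f = Set.restrict ((⋃ J ∈ S, J)ᶜ) ⇑g}) (x : I01) :
    (∃ J ∈ S, x ∈ J) ↔ x ∉ Fin' G := by
  constructor
  · rintro ⟨J, hJ, hx⟩ hF
    have hF' : (Orb G x).Finite := hF
    have := h4 J hJ x hx
    rw [show {y : I01 | ∃ g ∈ G, g x = y} = Orb G x from rfl, hF'.isClosed.closure_eq] at this
    exact (IsSubdomain.fup (h1 J hJ)).infinite (h1 J hJ).1 (hF'.subset this)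
  · intro hx
    by_contra hcon
    have hxc : x ∈ (⋃ J ∈ S, J)ᶜ := by
      simp only [mem_compl_iff, mem_iUnion, exists_prop]
      exact hcon
    refine hx ((h6.image fun f => f ⟨x, hxc⟩).subset ?_)
    rintro y ⟨g, hg, rfl⟩
    exact ⟨_, ⟨g, hg, rfl⟩, rfl⟩

theorem uniq_sub {G : Subgroup (Equiv.Perm I01)} {S S' : Finset (Set I01)}
    (h1 : ∀ J ∈ S, IsSubdomain J)
    (h2 : ∀ J ∈ S, ∀ g ∈ G, InvariantUnder g J)
    (h4 : ∀ J ∈ S, ∀ x ∈ J, J ⊆ closure {y : I01 | ∃ g ∈ G, g x = y})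
    (h1' : ∀ J ∈ S', IsSubdomain J)
    (h2' : ∀ J ∈ S', ∀ g ∈ G, InvariantUnder g J)
    (h4' : ∀ J ∈ S', ∀ x ∈ J, J ⊆ closure {y : I01 | ∃ g ∈ G, g x = y})
    (hc : ∀ x, (∃ J ∈ S, x ∈ J) → (∃ J ∈ S', x ∈ J)) : S ⊆ S' := by
  intro J hJ
  obtain ⟨x, hx⟩ := (h1 J hJ).1
  obtain ⟨J', hJ', hx'⟩ := hc x ⟨J, hJ, hx⟩
  have hJo : {y : I01 | ∃ g ∈ G, g x = y} ⊆ J := by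
    rintro y ⟨g, hg, rfl⟩
    exact (h2 J hJ g hg x).2 hx
  have hJo' : {y : I01 | ∃ g ∈ G, g x = y} ⊆ J' := by
    rintro y ⟨g, hg, rfl⟩
    exact (h2' J' hJ' g hg x).2 hx'
  have : J = J' := by
    apply Subset.antisymm
    · exact subset_of_closure (IsSubdomain.fup (h1 J hJ)) (IsSubdomain.fup (h1' J' hJ'))
        ((h4 J hJ x hx).trans (closure_mono hJo'))
    · exact subset_of_closure (IsSubdomain.fup (h1' J' hJ')) (IsSubdomain.fup (h1 J hJ))
        ((h4' J' hJ' x hx').trans (closure_mono hJo))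
  rwa [this]

end IETaux

/-- Imanishi-type decomposition: a finitely generated subgroup `G` of `IET` admits a unique
finite collection of pairwise disjoint `G`-invariant subdomains on each of which all
`G`-orbits are dense, and outside of which `G` restricts to a finite group of maps. -/
theorem unique_irreducible_components
    (G : Subgroup (Equiv.Perm I01)) (hG : ∀ g ∈ G, IsIET g) (hfg : Group.FG ↥G) :
    ∃! S : Finset (Set I01),
      (∀ J ∈ S, IsSubdomain J) ∧
      (∀ J ∈ S, ∀ g ∈ G, InvariantUnder g J) ∧
      (∀ J ∈ S, ∀ K ∈ S, J ≠ K → Disjoint J K) ∧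
      (∀ J ∈ S, ∀ x ∈ J, J ⊆ closure {y : I01 | ∃ g ∈ G, g x = y}) ∧
      (∀ g ∈ G, InvariantUnder g ((⋃ J ∈ S, J)ᶜ)) ∧
      Set.Finite {f : ((⋃ J ∈ S, J)ᶜ : Set I01) → I01 |
        ∃ g ∈ G, f = Set.restrict ((⋃ J ∈ S, J)ᶜ) ⇑g} := by
  classical
  obtain ⟨T, D, hS⟩ := IETaux.exists_setup G hG hfg
  have hfin := IETaux.rcl_family_finite hS
  have hmem : ∀ J, J ∈ hfin.toFinset ↔ ∃ x, x ∉ IETaux.Fin' G ∧ IETaux.rcl G x = J := by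
    intro J
    rw [Set.Finite.mem_toFinset]
    rfl
  have hun : (⋃ J ∈ hfin.toFinset, J)ᶜ = IETaux.Fin' G := by
    ext x
    simp only [Set.mem_compl_iff, Set.mem_iUnion, exists_prop]
    constructor
    · intro h
      by_contra hx
      exact h ⟨IETaux.rcl G x, (hmem _).2 ⟨x, hx, rfl⟩, IETaux.rcl_self G x⟩
    · rintro hx ⟨J, hJ, hxJ⟩
      obtain ⟨y, hy, rfl⟩ := (hmem J).1 hJ
      exact (IETaux.rcl_struct hS hy).2.2 x hxJ hx
  refine ⟨hfin.toFinset, ⟨?_, ?_, ?_, ?_, ?_, ?_⟩, ?_⟩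
  · intro J hJ
    obtain ⟨y, hy, rfl⟩ := (hmem J).1 hJ
    exact (IETaux.rcl_struct hS hy).1.isSubdomain ⟨y, IETaux.rcl_self G y⟩
  · intro J hJ
    obtain ⟨y, hy, rfl⟩ := (hmem J).1 hJ
    exact IETaux.inv_of_maps (IETaux.rcl_struct hS hy).2.1
  · intro J hJ K hK hne
    obtain ⟨y, hy, rfl⟩ := (hmem J).1 hJ
    obtain ⟨z, hz, rfl⟩ := (hmem K).1 hK
    rw [Set.disjoint_left]
    intro w hw hw'
    exact hne ((IETaux.rcl_eq hS hy hw).symm.trans (IETaux.rcl_eq hS hz hw'))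
  · intro J hJ x hx
    obtain ⟨y, hy, rfl⟩ := (hmem J).1 hJ
    rw [← IETaux.rcl_eq hS hy hx]
    exact IETaux.rcl_closure G x
  · intro g hg
    rw [hun]
    exact fun x => IETaux.Fin'.inv hg
  · exact IETaux.restrict_finite hS _ hun
  · rintro S' ⟨h1, h2, -, h4, -, h6⟩
    have h1' : ∀ J ∈ hfin.toFinset, IsSubdomain J := by
      intro J hJ
      obtain ⟨y, hy, rfl⟩ := (hmem J).1 hJ
      exact (IETaux.rcl_struct hS hy).1.isSubdomain ⟨y, IETaux.rcl_self G y⟩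
    have h2' : ∀ J ∈ hfin.toFinset, ∀ g ∈ G, InvariantUnder g J := by
      intro J hJ
      obtain ⟨y, hy, rfl⟩ := (hmem J).1 hJ
      exact IETaux.inv_of_maps (IETaux.rcl_struct hS hy).2.1
    have h4' : ∀ J ∈ hfin.toFinset, ∀ x ∈ J, J ⊆ closure {y : I01 | ∃ g ∈ G, g x = y} := by
      intro J hJ x hx
      obtain ⟨y, hy, rfl⟩ := (hmem J).1 hJ
      rw [← IETaux.rcl_eq hS hy hx]
      exact IETaux.rcl_closure G x
    have hc := IETaux.cover_eq h1 h4 h6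
    have hc' := IETaux.cover_eq h1' h4' (IETaux.restrict_finite hS _ hun)
    exact Finset.Subset.antisymm
      (IETaux.uniq_sub h1 h2 h4 h1' h2' h4' fun x hx => (hc' x).2 ((hc x).1 hx))
      (IETaux.uniq_sub h1' h2' h4' h1 h2 h4 fun x hx => (hc x).2 ((hc' x).1 hx))
end
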